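/- Let K be a nontrivial (K ≠ {0}) additive subgroup of ℝ and c ∈ K with c ≥ 0. Every MTL_K formula is equivalent to a boolean combination of formulas of the following three kinds: (i) ◇_{{N}} φ where pr(φ) < N − c; (ii) ◇⁻_{{N}} φ where fr(φ) < N − c; (iii) φ in which all intervals occurring in the temporal operators are bounded. -/

import Mathlib

namespace MTLPaper

variable {K : AddSubgroup ℝ} {P : Type}

/-- `K ⊆ ℝ` is dense: between any two elements of `K` there is another element of `K`. -/
def DenseK (K : AddSubgroup ℝ) : Prop :=
  ∀ a ∈ K, ∀ b ∈ K, a < b → ∃ c ∈ K, a < c ∧ c < b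

/-- A term of `FO_K`: a variable index together with a constant shift from `K`
(`(x, c)` denotes the term `x + c`; iterated shifts collapse since `K` is a group). -/
abbrev Term (K : AddSubgroup ℝ) : Type := ℕ × K

/-- Value of a term under a valuation of the variables. -/
def Term.val (v : ℕ → ℝ) (t : Term K) : ℝ := v t.1 + (t.2 : ℝ)

/-- Formulas of the monadic logic of order and metric `FO_K`, over monadic predicates `P`. -/
inductive FO (K : AddSubgroup ℝ) (P : Type) : Type
  | tt : FO K P
  | atom : P → Term K → FO K P
  | lt : Term K → Term K → FO K P
  | conj : FO K P → FO K P → FO K P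
  | neg : FO K P → FO K P
  | ex : ℕ → FO K P → FO K P

namespace FO

/-- Satisfaction of an `FO_K` formula over a signal `f` and a valuation `v`. -/
def sat (f : ℝ → Set P) : FO K P → (ℕ → ℝ) → Prop
  | tt, _ => True
  | atom p t, v => p ∈ f (Term.val v t)
  | lt s t, v => Term.val v s < Term.val v t
  | conj φ ψ, v => sat f φ v ∧ sat f ψ v
  | neg φ, v => ¬ sat f φ v
  | ex x φ, v => ∃ r : ℝ, sat f φ (Function.update v x r)

/-- Free variables of an `FO_K` formula. -/
def free : FO K P → Set ℕ
  | tt => ∅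
  | atom _ t => {t.1}
  | lt s t => {s.1, t.1}
  | conj φ ψ => free φ ∪ free ψ
  | neg φ => free φ
  | ex x φ => free φ \ {x}

/-- Quantifier depth. -/
def qdepth : FO K P → ℕ
  | tt => 0
  | atom _ _ => 0
  | lt _ _ => 0
  | conj φ ψ => max (qdepth φ) (qdepth ψ)
  | neg φ => qdepth φ
  | ex _ φ => qdepth φ + 1

/-- Quantifier-free formulas. -/
def QFree : FO K P → Prop
  | tt => True
  | atom _ _ => True
  | lt _ _ => True
  | conj φ ψ => QFree φ ∧ QFree ψ
  | neg φ => QFree φ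
  | ex _ _ => False

/-- `<`-free formulas. -/
def LtFree : FO K P → Prop
  | tt => True
  | atom _ _ => True
  | lt _ _ => False
  | conj φ ψ => LtFree φ ∧ LtFree ψ
  | neg φ => LtFree φ
  | ex _ φ => LtFree φ

/-- Membership in `Bet_K(t₁,t₂)`: every quantified subformula `∃z ψ` has the form
`∃z ((t₁ < z < t₂) ∧ χ)`, and every monadic atom `P(t)` has `t` a bound occurrence of a
variable (no shift).  `B` records the set of variables bound so far. -/
def Bet (t₁ t₂ : Term K) : FO K P → Set ℕ → Prop
  | tt, _ => True
  | atom _ t, B => t.2 = (0 : K) ∧ t.1 ∈ B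
  | lt _ _, _ => True
  | conj φ ψ, B => Bet t₁ t₂ φ B ∧ Bet t₁ t₂ ψ B
  | neg φ, B => Bet t₁ t₂ φ B
  | ex z (conj (conj (lt s u) (lt u' t)) χ), B =>
      s = t₁ ∧ t = t₂ ∧ u = (z, (0 : K)) ∧ u' = (z, (0 : K)) ∧ Bet t₁ t₂ χ (insert z B)
  | ex _ _, _ => False

/-- `φ(x)` is `N`-bounded: it belongs to `Bet_K(x - N, x + N)`. -/
def NBounded (x : ℕ) (N : K) (φ : FO K P) : Prop :=
  Bet (x, -N) (x, N) φ (∅ : Set ℕ)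

/-- The relativized quantifier `∃ y ∈ (s, t). φ`. -/
def guard (s t : Term K) (y : ℕ) (φ : FO K P) : FO K P :=
  ex y (conj (conj (lt s (y, (0 : K))) (lt (y, (0 : K)) t)) φ)

/-- The guard interval of the body of a quantifier on `z`, if it has guarded shape. -/
def guardOf (z : ℕ) : FO K P → Set (Term K × Term K)
  | conj (conj (lt s u) (lt u' t)) _ =>
      {p | u = (z, (0 : K)) ∧ u' = (z, (0 : K)) ∧ p = (s, t)}
  | _ => ∅

/-- The guard intervals occurring in a formula. -/
def intervals : FO K P → Set (Term K × Term K)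
  | tt => ∅
  | atom _ _ => ∅
  | lt _ _ => ∅
  | conj φ ψ => intervals φ ∪ intervals ψ
  | neg φ => intervals φ
  | ex z φ => guardOf z φ ∪ intervals φ

/-- Hierarchical Interval Formulas (HIFs).  Every `<`-free quantifier-free formula is a HIF;
HIFs are closed under negation and disjunction (`φ ∨ ψ := ¬(¬φ ∧ ¬ψ)`); and if `φ(x̄, y)` is a
HIF such that the only guard intervals in `φ` involving `y` and a variable free in `φ` are of
the form `(x_l + c_l + c, y + c)` or `(y + c, x_r + c_r + c)` for some `c ∈ K`, then
`∃ y ∈ (x_l + c_l, x_r + c_r). φ` is a HIF. -/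
inductive IsHIF : FO K P → Prop
  | base {φ : FO K P} : QFree φ → LtFree φ → IsHIF φ
  | negI {φ : FO K P} : IsHIF φ → IsHIF (neg φ)
  | disjI {φ ψ : FO K P} : IsHIF φ → IsHIF ψ → IsHIF (neg (conj (neg φ) (neg ψ)))
  | exI {φ : FO K P} {y xl xr : ℕ} {cl cr : K} :
      IsHIF φ → xl ≠ y → xr ≠ y →
      (∀ s t : Term K, (s, t) ∈ intervals φ →
        (s.1 = y → t.1 ≠ y → t.1 ∈ free φ → ∃ c : K, s = (y, c) ∧ t = (xr, cr + c)) ∧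
        (t.1 = y → s.1 ≠ y → s.1 ∈ free φ → ∃ c : K, t = (y, c) ∧ s = (xl, cl + c))) →
      IsHIF (guard (xl, cl) (xr, cr) y φ)

/-- A conjunction of constraints of the form `x_j + c < x_k + c'`. -/
def IsConstraintConj : FO K P → Prop
  | tt => True
  | atom _ _ => False
  | lt _ _ => True
  | conj φ ψ => IsConstraintConj φ ∧ IsConstraintConj ψ
  | neg _ => False
  | ex _ _ => False

/-- The term `t` applies no nonzero shift unless its variable is `x`. -/
def TermOnly (x : ℕ) (t : Term K) : Prop := t.2 = (0 : K) ∨ t.1 = x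

/-- The unary functions `+c` are applied only to the variable `x`. -/
def FnOnly (x : ℕ) : FO K P → Prop
  | tt => True
  | atom _ t => TermOnly x t
  | lt s t => TermOnly x s ∧ TermOnly x t
  | conj φ ψ => FnOnly x φ ∧ FnOnly x ψ
  | neg φ => FnOnly x φ
  | ex _ φ => FnOnly x φ

end FO

/-- Equivalence of two `FO_K` formulas: same truth value for every signal and valuation. -/
def EquivFO (φ ψ : FO K P) : Prop :=
  ∀ (f : ℝ → Set P) (v : ℕ → ℝ), φ.sat f v ↔ ψ.sat f v

/-- An interval `I ⊆ (0,∞)` with endpoints in `K_{≥0} ∪ {∞}` (`hi = none` means `∞`). -/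
structure MTLI (K : AddSubgroup ℝ) where
  lo : ℝ
  lo_mem : lo ∈ K
  lo_nonneg : 0 ≤ lo
  loClosed : Bool
  hi : Option ℝ
  hi_mem : ∀ h : ℝ, hi = some h → h ∈ K ∧ 0 ≤ h
  hiClosed : Bool
  pos : lo = 0 → loClosed = false

namespace MTLI

/-- Membership in the interval. -/
def mem (I : MTLI K) (t : ℝ) : Prop :=
  (if I.loClosed then I.lo ≤ t else I.lo < t) ∧
  ∀ h : ℝ, I.hi = some h → (if I.hiClosed then t ≤ h else t < h)

/-- The interval is bounded. -/
def Bounded (I : MTLI K) : Prop := I.hi ≠ none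

/-- The supremum of the interval, in `ℝ ∪ {∞}`. -/
def supW (I : MTLI K) : WithTop ℝ :=
  match I.hi with
  | none => ⊤
  | some h => (h : WithTop ℝ)

/-- The singleton (punctual) interval `{N}`, for `N ∈ K`, `N > 0`. -/
def single (N : ℝ) (hm : N ∈ K) (h0 : 0 < N) : MTLI K where
  lo := N
  lo_mem := hm
  lo_nonneg := h0.le
  loClosed := true
  hi := some N
  hi_mem := fun h hh => by
    obtain rfl := (Option.some.inj hh).symm
    exact ⟨hm, h0.le⟩
  hiClosed := true
  pos := fun h => absurd h h0.ne'

/-- The unconstrained interval `(0, ∞)`. -/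
def full : MTLI K where
  lo := 0
  lo_mem := zero_mem K
  lo_nonneg := le_refl 0
  loClosed := false
  hi := none
  hi_mem := fun _ hh => nomatch hh
  hiClosed := false
  pos := fun _ => rfl

end MTLI

/-- Formulas of `MTL_K` over atomic propositions `P`. -/
inductive MTL (K : AddSubgroup ℝ) (P : Type) : Type
  | tt : MTL K P
  | atom : P → MTL K P
  | conj : MTL K P → MTL K P → MTL K P
  | neg : MTL K P → MTL K P
  | untl : MTL K P → MTL K P → MTLI K → MTL K P
  | sinc : MTL K P → MTL K P → MTLI K → MTL K P

namespace MTL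

/-- Satisfaction of an `MTL_K` formula over a signal, at a point.
`untl φ ψ I` is `φ U_I ψ` and `sinc φ ψ I` is `φ S_I ψ`. -/
def sat (f : ℝ → Set P) : MTL K P → ℝ → Prop
  | tt, _ => True
  | atom p, r => p ∈ f r
  | conj φ ψ, r => sat f φ r ∧ sat f ψ r
  | neg φ, r => ¬ sat f φ r
  | untl φ ψ I, r =>
      ∃ t : ℝ, r < t ∧ I.mem (t - r) ∧ sat f ψ t ∧ ∀ u, r < u → u < t → sat f φ u
  | sinc φ ψ I, r =>
      ∃ t : ℝ, t < r ∧ I.mem (r - t) ∧ sat f ψ t ∧ ∀ u, t < u → u < r → sat f φ u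

/-- All intervals occurring in the temporal operators are bounded. -/
def AllBounded : MTL K P → Prop
  | tt => True
  | atom _ => True
  | conj φ ψ => AllBounded φ ∧ AllBounded ψ
  | neg φ => AllBounded φ
  | untl φ ψ I => I.Bounded ∧ AllBounded φ ∧ AllBounded ψ
  | sinc φ ψ I => I.Bounded ∧ AllBounded φ ∧ AllBounded ψ

/-- LTL formulas: MTL formulas using only the interval `(0, ∞)`. -/
def IsLTL : MTL K P → Prop
  | tt => True
  | atom _ => True
  | conj φ ψ => IsLTL φ ∧ IsLTL ψ
  | neg φ => IsLTL φ
  | untl φ ψ I => I = MTLI.full ∧ IsLTL φ ∧ IsLTL ψ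
  | sinc φ ψ I => I = MTLI.full ∧ IsLTL φ ∧ IsLTL ψ

/-- Future reach. -/
noncomputable def fr : MTL K P → WithTop ℝ
  | tt => 0
  | atom _ => 0
  | conj φ ψ => max (fr φ) (fr ψ)
  | neg φ => fr φ
  | untl φ ψ I => I.supW + max (fr φ) (fr ψ)
  | sinc φ ψ I => max (fr φ) (WithTop.map (fun x => x - I.lo) (fr ψ))

/-- Past reach. -/
noncomputable def pr : MTL K P → WithTop ℝ
  | tt => 0
  | atom _ => 0
  | conj φ ψ => max (pr φ) (pr ψ)
  | neg φ => pr φ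
  | untl φ ψ I => max (pr φ) (WithTop.map (fun x => x - I.lo) (pr ψ))
  | sinc φ ψ I => I.supW + max (pr φ) (pr ψ)

/-- Boolean combinations of formulas from a class `S`. -/
inductive BC (S : MTL K P → Prop) : MTL K P → Prop
  | base {φ : MTL K P} : S φ → BC S φ
  | negB {φ : MTL K P} : BC S φ → BC S (neg φ)
  | conjB {φ ψ : MTL K P} : BC S φ → BC S ψ → BC S (conj φ ψ)

end MTL

/-- Equivalence of two `MTL_K` formulas. -/
def EquivMTL (φ ψ : MTL K P) : Prop :=
  ∀ (f : ℝ → Set P) (r : ℝ), φ.sat f r ↔ ψ.sat f r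

/-- Equivalence of an `FO_K` formula with (at most) free variable `0` and an `MTL_K` formula. -/
def EquivFOMTL (φ : FO K P) (ψ : MTL K P) : Prop :=
  ∀ (f : ℝ → Set P) (r : ℝ), φ.sat f (fun _ => r) ↔ ψ.sat f r

/-- `MTL_K` and `FO_K` have the same expressive power. -/
def SameExpressive (K : AddSubgroup ℝ) (P : Type) : Prop :=
  (∀ φ : FO K P, φ.free ⊆ {0} → ∃ ψ : MTL K P, EquivFOMTL φ ψ) ∧
  (∀ ψ : MTL K P, ∃ φ : FO K P, φ.free ⊆ {0} ∧ EquivFOMTL φ ψ)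

/-- Formulas of `MTL_K` with counting modalities. -/
inductive MTLC (K : AddSubgroup ℝ) (P : Type) : Type
  | tt : MTLC K P
  | atom : P → MTLC K P
  | conj : MTLC K P → MTLC K P → MTLC K P
  | neg : MTLC K P → MTLC K P
  | untl : MTLC K P → MTLC K P → MTLI K → MTLC K P
  | sinc : MTLC K P → MTLC K P → MTLI K → MTLC K P
  | fcount : ℕ → MTLC K P → MTLC K P
  | pcount : ℕ → MTLC K P → MTLC K P

namespace MTLC

/-- Satisfaction of an `MTL_K+C` formula. -/
def sat (f : ℝ → Set P) : MTLC K P → ℝ → Prop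
  | tt, _ => True
  | atom p, r => p ∈ f r
  | conj φ ψ, r => sat f φ r ∧ sat f ψ r
  | neg φ, r => ¬ sat f φ r
  | untl φ ψ I, r =>
      ∃ t : ℝ, r < t ∧ I.mem (t - r) ∧ sat f ψ t ∧ ∀ u, r < u → u < t → sat f φ u
  | sinc φ ψ I, r =>
      ∃ t : ℝ, t < r ∧ I.mem (r - t) ∧ sat f ψ t ∧ ∀ u, t < u → u < r → sat f φ u
  | fcount n φ, r =>
      ∃ s : Fin n → ℝ, StrictMono s ∧ ∀ i, s i ∈ Set.Ioo r (r + 1) ∧ sat f φ (s i)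
  | pcount n φ, r =>
      ∃ s : Fin n → ℝ, StrictMono s ∧ ∀ i, s i ∈ Set.Ioo (r - 1) r ∧ sat f φ (s i)

end MTLC

/-- The integers, as an additive subgroup of `ℝ`. -/
def intZ : AddSubgroup ℝ := AddSubgroup.zmultiples (1 : ℝ)

/-- Equivalence of an `FO_K` formula with free variable `0` and an `MTL_K+C` formula. -/
def EquivFOMTLC (φ : FO K P) (ψ : MTLC K P) : Prop :=
  ∀ (f : ℝ → Set P) (r : ℝ), φ.sat f (fun _ => r) ↔ ψ.sat f r

/-- Formulas of PQ2MLO: Q2MLO with punctuality. -/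
inductive PQ (P : Type) : Type
  | tt : PQ P
  | atom : P → ℕ → PQ P
  | lt : ℕ → ℕ → PQ P
  | conj : PQ P → PQ P → PQ P
  | neg : PQ P → PQ P
  | ex : ℕ → PQ P → PQ P
  | exFutI : ℕ → ℕ → PQ P → PQ P  -- ∃ y ∈ (x, x+1). ψ
  | exPastI : ℕ → ℕ → PQ P → PQ P -- ∃ y ∈ (x-1, x). ψ
  | exFutP : ℕ → ℕ → PQ P → PQ P  -- ∃ y (y = x+1 ∧ χ)
  | exPastP : ℕ → ℕ → PQ P → PQ P -- ∃ y (y = x-1 ∧ χ)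

namespace PQ

/-- Satisfaction of a PQ2MLO formula. -/
def sat (f : ℝ → Set P) : PQ P → (ℕ → ℝ) → Prop
  | tt, _ => True
  | atom p x, v => p ∈ f (v x)
  | lt x y, v => v x < v y
  | conj φ ψ, v => sat f φ v ∧ sat f ψ v
  | neg φ, v => ¬ sat f φ v
  | ex x φ, v => ∃ r : ℝ, sat f φ (Function.update v x r)
  | exFutI x y ψ, v => ∃ r : ℝ, v x < r ∧ r < v x + 1 ∧ sat f ψ (Function.update v y r)
  | exPastI x y ψ, v => ∃ r : ℝ, v x - 1 < r ∧ r < v x ∧ sat f ψ (Function.update v y r)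
  | exFutP x y χ, v => ∃ r : ℝ, r = v x + 1 ∧ sat f χ (Function.update v y r)
  | exPastP x y χ, v => ∃ r : ℝ, r = v x - 1 ∧ sat f χ (Function.update v y r)

/-- Free variables of a PQ2MLO formula. -/
def free : PQ P → Set ℕ
  | tt => ∅
  | atom _ x => {x}
  | lt x y => {x, y}
  | conj φ ψ => free φ ∪ free ψ
  | neg φ => free φ
  | ex x φ => free φ \ {x}
  | exFutI x y ψ => insert x (free ψ \ {y})
  | exPastI x y ψ => insert x (free ψ \ {y})
  | exFutP x y χ => insert x (free χ \ {y})
  | exPastP x y χ => insert x (free χ \ {y})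

/-- Well-formedness: in `∃y∈(x,x+1) ψ` and `∃y∈(x-1,x) ψ` the formula `ψ` has exactly the
free variables `x` and `y`; in `∃y (y = x±1 ∧ χ)` the formula `χ` has exactly the free
variable `y`. -/
def WF : PQ P → Prop
  | tt => True
  | atom _ _ => True
  | lt _ _ => True
  | conj φ ψ => WF φ ∧ WF ψ
  | neg φ => WF φ
  | ex _ φ => WF φ
  | exFutI x y ψ => x ≠ y ∧ free ψ = {x, y} ∧ WF ψ
  | exPastI x y ψ => x ≠ y ∧ free ψ = {x, y} ∧ WF ψ
  | exFutP x y χ => x ≠ y ∧ free χ = {y} ∧ WF χ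
  | exPastP x y χ => x ≠ y ∧ free χ = {y} ∧ WF χ

end PQ

/-- Equivalence of an `FO_ℤ` formula with free variable `0` and a PQ2MLO formula
with free variable `0`. -/
def EquivFOPQ (φ : FO intZ P) (π : PQ P) : Prop :=
  ∀ (f : ℝ → Set P) (r : ℝ), φ.sat f (fun _ => r) ↔ π.sat f (fun _ => r)

/-- Equivalence of a PQ2MLO formula with free variable `0` and an `MTL_ℤ+C` formula. -/
def EquivPQMTLC (π : PQ P) (ψ : MTLC intZ P) : Prop :=
  ∀ (f : ℝ → Set P) (r : ℝ), π.sat f (fun _ => r) ↔ ψ.sat f r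

/-- The singleton interval `{1}` over the integer constants. -/
def oneI : MTLI intZ := MTLI.single 1 (AddSubgroup.mem_zmultiples (1 : ℝ)) one_pos

/-- The interpretation of the enlarged set of monadic predicates: the predicate `(p, c)`
(i.e. `P^c`) holds at `r` iff `p` holds at `r + c`. -/
def liftSig (K : AddSubgroup ℝ) (f : ℝ → Set P) : ℝ → Set (P × K) :=
  fun r => {pc : P × K | pc.1 ∈ f (r + (pc.2 : ℝ))}

/-- Semantics of a decomposition formula `δ(x,y)`:
`x < y ∧ ∃ z₀ … zₙ (x = z₀ < ⋯ < zₙ = y) ∧ ⋀ φᵢ(zᵢ) ∧ ⋀ ∀u (z_{i-1} < u < z_i → ψᵢ(u))`,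
where the `φᵢ`, `ψᵢ` are MTL formulas regarded as unary predicates. -/
def DecompSat (f : ℝ → Set P) (n : ℕ) (φ ψ : ℕ → MTL K P) (x y : ℝ) : Prop :=
  x < y ∧ ∃ z : ℕ → ℝ, z 0 = x ∧ z n = y ∧ (∀ i < n, z i < z (i + 1)) ∧
    (∀ i, 0 < i → i < n → (φ i).sat f (z i)) ∧
    (∀ i, 0 < i → i ≤ n → ∀ u, z (i - 1) < u → u < z i → (ψ i).sat f u)

/-- Semantics of `δ(x,y)` for abstract unary predicates (no `x < y` conjunct). -/
def Delta (φ ψ : ℕ → ℝ → Prop) (n : ℕ) (x y : ℝ) : Prop :=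
  ∃ z : ℕ → ℝ, z 0 = x ∧ z n = y ∧ (∀ i < n, z i < z (i + 1)) ∧
    (∀ i, 0 < i → i < n → φ i (z i)) ∧
    (∀ i, 0 < i → i ≤ n → ∀ u, z (i - 1) < u → u < z i → ψ i u)

/-- Semantics of `δⱼ(x,y)`: the restriction of `δ` to the first `j` formulas of
`ψ₁, φ₁, ψ₂, φ₂, …, ψₙ`, with `k = ⌈j/2⌉` existential quantifiers after `z₀`. -/
def DeltaJ (φ ψ : ℕ → ℝ → Prop) (j : ℕ) (x y : ℝ) : Prop :=
  ∃ z : ℕ → ℝ, z 0 = x ∧ z ((j + 1) / 2) = y ∧ (∀ i < (j + 1) / 2, z i < z (i + 1)) ∧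
    (∀ i, 0 < i → i ≤ j / 2 → φ i (z i)) ∧
    (∀ i, 0 < i → i ≤ (j + 1) / 2 → ∀ u, z (i - 1) < u → u < z i → ψ i u)

/-- The three kinds of formulas in the separation lemma, for the constant `c`:
`◇_{{N}} θ` with `pr θ < N - c`; `◇⁻_{{N}} θ` with `fr θ < N - c`; and formulas in which
all intervals of temporal operators are bounded. -/
def SepKind (c : ℝ) (χ : MTL K P) : Prop :=
  (∃ (N : ℝ) (hm : N ∈ K) (h0 : 0 < N) (θ : MTL K P),
      χ = MTL.untl MTL.tt θ (MTLI.single N hm h0) ∧ θ.pr < ((N - c : ℝ) : WithTop ℝ)) ∨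
  (∃ (N : ℝ) (hm : N ∈ K) (h0 : 0 < N) (θ : MTL K P),
      χ = MTL.sinc MTL.tt θ (MTLI.single N hm h0) ∧ θ.fr < ((N - c : ℝ) : WithTop ℝ)) ∨
  χ.AllBounded


/-- The strict until operator on predicates over the real line. -/
def LineU (A B : ℝ → Prop) (r : ℝ) : Prop :=
  ∃ t, r < t ∧ B t ∧ ∀ u, r < u → u < t → A u

/-- The strict since operator on predicates over the real line. -/
def LineS (A B : ℝ → Prop) (r : ℝ) : Prop :=
  ∃ t, t < r ∧ B t ∧ ∀ u, t < u → u < r → A u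

/-- Since with a witness at distance less than `L`. -/
def LineSB (L : ℝ) (A B : ℝ → Prop) (r : ℝ) : Prop :=
  ∃ t, t < r ∧ r - t < L ∧ B t ∧ ∀ u, t < u → u < r → A u

/-- Until with a witness at distance less than `L`. -/
def LineUB (L : ℝ) (A B : ℝ → Prop) (r : ℝ) : Prop :=
  ∃ t, r < t ∧ t - r < L ∧ B t ∧ ∀ u, r < u → u < t → A u

/-- Far from its endpoint, an unbounded since is determined by bounded data and by its value
at one earlier point. -/
lemma lineS_iff_of_far {α β : ℝ → Prop} {L t q : ℝ} (hq : q < t) (hL : t - q < L) :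
    LineS α β t ↔ LineSB L α β t ∨ ((∀ u, u < t → t - u < L → α u) ∧ LineS α β q) := by
  constructor
  · rintro ⟨u, hu, hb, ha⟩
    by_cases h : t - u < L
    · exact Or.inl ⟨u, hu, h, hb, ha⟩
    · exact Or.inr ⟨fun w hw hwL => ha w (by linarith) hw,
        u, by linarith, hb, fun w h1 h2 => ha w h1 (by linarith)⟩
  · rintro (⟨u, hu, -, hb, ha⟩ | ⟨h, u, hu, hb, ha⟩)
    · exact ⟨u, hu, hb, ha⟩
    · refine ⟨u, by linarith, hb, fun w h1 h2 => ?_⟩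
      by_cases hw : w < q
      · exact ha w h1 hw
      · exact h w h2 (by linarith)

/-- Far from its starting point, an unbounded until is determined by bounded data and by its
value at one later point. -/
lemma lineU_iff_of_far {α β : ℝ → Prop} {L t q : ℝ} (hq : t < q) (hL : q - t < L) :
    LineU α β t ↔ LineUB L α β t ∨ ((∀ u, t < u → u - t < L → α u) ∧ LineU α β q) := by
  constructor
  · rintro ⟨u, hu, hb, ha⟩
    by_cases h : u - t < L
    · exact Or.inl ⟨u, hu, h, hb, ha⟩
    · exact Or.inr ⟨fun w hw hwL => ha w hw (by linarith),
        u, by linarith, hb, fun w h1 h2 => ha w (by linarith) h2⟩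
  · rintro (⟨u, hu, -, hb, ha⟩ | ⟨h, u, hu, hb, ha⟩)
    · exact ⟨u, hu, hb, ha⟩
    · refine ⟨u, by linarith, hb, fun w h1 h2 => ?_⟩
      by_cases hw : q < w
      · exact ha w hw h2
      · exact h w h1 (by linarith)

/-- `α ∧ ¬β` holds throughout the preceding open interval of length `L`, so that the truth of
`α S β` is not determined by that interval. -/
def Ambig (L : ℝ) (α β : ℝ → Prop) (t : ℝ) : Prop :=
  ∀ u, u < t → t - u < L → α u ∧ ¬ β u

section Line

variable {L : ℝ} {α β : ℝ → Prop}

lemma lineS_iff_of_not_ambig {t : ℝ} (h : ¬ Ambig L α β t) :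
    LineS α β t ↔ LineSB L α β t := by
  constructor
  · rintro ⟨u, hu, hb, ha⟩
    by_contra hn
    have hf : ¬ t - u < L := fun h' => hn ⟨u, hu, h', hb, ha⟩
    refine h fun w hw hwL => ⟨ha w (by linarith) hw, fun hbw => ?_⟩
    exact hn ⟨w, hw, hwL, hbw, fun v h1 h2 => ha v (by linarith) h2⟩
  · rintro ⟨u, hu, -, hb, ha⟩
    exact ⟨u, hu, hb, ha⟩

lemma Ambig.lineS_iff_of_near {v z : ℝ} (hz : Ambig L α β z) (hv : v < z) (hL : z - v < L) :
    LineS α β v ↔ LineS α β z := by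
  constructor
  · rintro ⟨u, hu, hb, ha⟩
    refine ⟨u, by linarith, hb, fun w h1 h2 => ?_⟩
    by_cases hw : w < v
    · exact ha w h1 hw
    · exact (hz w h2 (by linarith)).1
  · rintro ⟨u, hu, hb, ha⟩
    have : ¬ z - u < L := fun h => (hz u hu h).2 hb
    exact ⟨u, by linarith, hb, fun w h1 h2 => ha w h1 (by linarith)⟩

lemma lineS_iff_of_ambig_Icc {z v : ℝ} (hL : 0 < L) (hzv : z ≤ v)
    (h : ∀ w, z ≤ w → w ≤ v → Ambig L α β w) : LineS α β z ↔ LineS α β v := by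
  have key : ∀ w, z - L < w → w < v → α w ∧ ¬ β w := by
    intro w h1 h2
    by_cases hw : w < z
    · exact h z le_rfl hzv w hw (by linarith)
    · refine h (min v (w + L / 2)) (le_min hzv (by linarith)) (min_le_left _ _) w
        (lt_min h2 (by linarith)) ?_
      linarith [min_le_right v (w + L / 2)]
  constructor
  · rintro ⟨u, hu, hb, ha⟩
    refine ⟨u, by linarith, hb, fun w h1 h2 => ?_⟩
    by_cases hw : w < z
    · exact ha w h1 hw
    · exact (key w (by linarith) h2).1
  · rintro ⟨u, hu, hb, ha⟩
    have : ¬ z - L < u := fun h' => (key u h' hu).2 hb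
    exact ⟨u, by linarith, hb, fun w h1 h2 => ha w h1 (by linarith)⟩

lemma ambig_of_Ioc {r v : ℝ} (hrv : r < v) (h : ∀ w, r < w → w ≤ v → Ambig L α β w) :
    Ambig L α β r := by
  intro u hu huL
  refine h (min v ((u + L + r) / 2)) (lt_min hrv (by linarith)) (min_le_left _ _) u
    (lt_min (by linarith) (by linarith)) ?_
  linarith [min_le_right v ((u + L + r) / 2)]

lemma ambig_of_Ioo {r y : ℝ} (hry : r < y) (h : ∀ w, r < w → w < y → Ambig L α β w) :
    Ambig L α β y := by
  intro u hu huL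
  obtain ⟨y', h1, h2⟩ := exists_between (max_lt hu hry)
  have := le_max_left u r
  have := le_max_right u r
  exact h y' (by linarith) h2 u (by linarith) (by linarith)

/-- The start of the maximal ambiguous run containing `v`. -/
lemma exists_run_start {w v : ℝ} (hL : 0 < L) (hv : Ambig L α β v) (hwv : w < v)
    (hw : ¬ Ambig L α β w) :
    ∃ z, w < z ∧ z ≤ v ∧ (∀ x, z ≤ x → x ≤ v → Ambig L α β x) ∧
      (∃ u, u < z ∧ z - u < L ∧ ¬ Ambig L α β u) ∧
      ∀ z', z' ≤ v → (∀ x, z' ≤ x → x ≤ v → Ambig L α β x) → z ≤ z' := by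
  set S : Set ℝ := {z | z ≤ v ∧ ∀ x, z ≤ x → x ≤ v → Ambig L α β x} with hS
  have hvS : v ∈ S := ⟨le_rfl, fun x h1 h2 => le_antisymm h2 h1 ▸ hv⟩
  have hlb : ∀ z ∈ S, w < z := fun z hz => by
    by_contra! h
    exact hw (hz.2 w h hwv.le)
  have hbdd : BddBelow S := ⟨w, fun z hz => (hlb z hz).le⟩
  have hle : sInf S ≤ v := csInf_le hbdd hvS
  have hIoc : ∀ x, sInf S < x → x ≤ v → Ambig L α β x := by
    intro x h1 h2
    obtain ⟨z, hz, hzx⟩ := exists_lt_of_csInf_lt ⟨v, hvS⟩ h1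
    exact hz.2 x hzx.le h2
  have hmem : sInf S ∈ S := by
    refine ⟨hle, fun x h1 h2 => ?_⟩
    rcases h1.lt_or_eq with h1 | h1
    · exact hIoc x h1 h2
    · rcases h2.lt_or_eq with h2 | h2
      · exact ambig_of_Ioc h2 fun y hy hyv => hIoc y (h1 ▸ hy) hyv
      · exact h2 ▸ hv
  refine ⟨sInf S, hlb _ hmem, hle, hmem.2, ?_, fun z' h1 h2 => csInf_le hbdd ⟨h1, h2⟩⟩
  by_contra! hcon
  have : sInf S - L / 2 ∈ S := by
    refine ⟨by linarith, fun x h1 h2 => ?_⟩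
    by_cases hx : x < sInf S
    · exact hcon x hx (by linarith)
    · exact hmem.2 x (by linarith) h2
  linarith [csInf_le hbdd this]

/-- The end of the maximal ambiguous run starting at `r`. -/
lemma exists_run_end {r v w : ℝ} (hrv : r < v) (hv : ∀ x, r < x → x ≤ v → Ambig L α β x)
    (hrw : r < w) (hw : ¬ Ambig L α β w) :
    ∃ y, r < y ∧ y < w ∧ (∀ x, r < x → x ≤ y → Ambig L α β x) ∧
      ¬ LineU (Ambig L α β) (Ambig L α β) y := by
  set S : Set ℝ := {y | ∀ x, r < x → x ≤ y → Ambig L α β x} with hS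
  have hub : ∀ y ∈ S, y < w := fun y hy => by
    by_contra! h
    exact hw (hy w hrw h)
  have hbdd : BddAbove S := ⟨w, fun y hy => (hub y hy).le⟩
  have hle : v ≤ sSup S := le_csSup hbdd hv
  have hIoo : ∀ x, r < x → x < sSup S → Ambig L α β x := by
    intro x h1 h2
    obtain ⟨y, hy, hxy⟩ := exists_lt_of_lt_csSup (s := S) ⟨v, hv⟩ h2
    exact hy x h1 hxy.le
  have hmem : sSup S ∈ S := by
    intro x h1 h2
    rcases h2.lt_or_eq with h2 | h2
    · exact hIoo x h1 h2
    · subst h2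
      exact ambig_of_Ioo h1 hIoo
  refine ⟨sSup S, by linarith, hub _ hmem, hmem, ?_⟩
  rintro ⟨t, ht, htZ, hts⟩
  have : t ∈ S := by
    intro x h1 h2
    by_cases hx : x ≤ sSup S
    · exact hmem x h1 hx
    · rcases h2.lt_or_eq with h2 | h2
      · exact hts x (by linarith) h2
      · exact h2 ▸ htZ
  linarith [le_csSup hbdd this]

/-- An ambiguous point close to an earlier unambiguous point. -/
def Fresh (L : ℝ) (α β : ℝ → Prop) (z : ℝ) : Prop :=
  Ambig L α β z ∧ ∃ u, u < z ∧ z - u < L ∧ ¬ Ambig L α β u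

/-- The value of `α S β` at a fresh point, in terms of bounded operators. -/
def Entry (L : ℝ) (α β : ℝ → Prop) (z : ℝ) : Prop :=
  ∃ u, u < z ∧ z - u < L ∧ LineSB L α β u

lemma Fresh.lineS_iff {z : ℝ} (h : Fresh L α β z) : LineS α β z ↔ Entry L α β z := by
  obtain ⟨hz, u, hu, huL, hn⟩ := h
  constructor
  · intro hs
    exact ⟨u, hu, huL, (lineS_iff_of_not_ambig hn).1 ((hz.lineS_iff_of_near hu huL).2 hs)⟩
  · rintro ⟨w, hw, hwL, x, hx, -, hb, ha⟩
    exact (hz.lineS_iff_of_near hw hwL).1 ⟨x, hx, hb, ha⟩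

/-- The invariant of the since-free form of `A U B`: it checks `A` at unambiguous points, and at
fresh points on the whole rest of the ambiguous run. -/
def RunGuard (L : ℝ) (α β : ℝ → Prop) (A : Prop → ℝ → Prop) (v : ℝ) : Prop :=
  (¬ Ambig L α β v → A (LineSB L α β v) v) ∧
  (Fresh L α β v → A (Entry L α β v) v ∧
    ¬ LineU (Ambig L α β) (fun w => Ambig L α β w ∧ ¬ A (Entry L α β v) w) v)

/-- The goal of the since-free form of `A U B`: the witness is unambiguous, or lies in an
ambiguous run and is announced at its fresh start. -/
def RunGoal (L : ℝ) (α β : ℝ → Prop) (A B : Prop → ℝ → Prop) (v : ℝ) : Prop :=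
  (¬ Ambig L α β v ∧ B (LineSB L α β v) v) ∨
  (Fresh L α β v ∧ (B (Entry L α β v) v ∨ (A (Entry L α β v) v ∧
    LineU (fun w => Ambig L α β w ∧ A (Entry L α β v) w)
      (fun w => Ambig L α β w ∧ B (Entry L α β v) w) v)))

lemma lineU_iff_of_no_run {A B : Prop → ℝ → Prop} {r : ℝ} (hL : 0 < L)
    (hr : ¬ LineU (Ambig L α β) (Ambig L α β) r) :
    LineU (fun v => A (LineS α β v) v) (fun v => B (LineS α β v) v) r ↔
      LineU (RunGuard L α β A) (RunGoal L α β A B) r := by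
  have start : ∀ v, r < v → Ambig L α β v → ∃ z, r < z ∧ z ≤ v ∧
      (∀ x, z ≤ x → x ≤ v → Ambig L α β x) ∧ Fresh L α β z ∧
      ∀ z', z' ≤ v → (∀ x, z' ≤ x → x ≤ v → Ambig L α β x) → z ≤ z' := by
    intro v hrv hv
    have : ∃ w, r < w ∧ w < v ∧ ¬ Ambig L α β w := by
      by_contra! h
      exact hr ⟨v, hrv, hv, h⟩
    obtain ⟨w, h1, h2, h3⟩ := this
    obtain ⟨z, hz1, hz2, hz3, hz4, hz5⟩ := exists_run_start hL hv h2 h3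
    exact ⟨z, by linarith, hz2, hz3, ⟨hz3 z le_rfl hz2, hz4⟩, hz5⟩
  have guard : ∀ t t', (∀ u, r < u → u < t → A (LineS α β u) u) → t' ≤ t →
      (∀ v, r < v → v < t' → ¬ ∀ x, v ≤ x → x ≤ t → Ambig L α β x) →
      ∀ u, r < u → u < t' → RunGuard L α β A u := by
    intro t t' hA ht' hno u hru hut
    refine ⟨fun hn => ?_, fun hf => ⟨?_, ?_⟩⟩
    · rw [← propext (lineS_iff_of_not_ambig hn)]
      exact hA u hru (by linarith)
    · rw [← propext hf.lineS_iff]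
      exact hA u hru (by linarith)
    · rw [← propext hf.lineS_iff]
      rintro ⟨x, hux, ⟨hx, hnA⟩, hZ⟩
      have hrun : ∀ y, u ≤ y → y ≤ x → Ambig L α β y := by
        intro y h1 h2
        rcases h1.lt_or_eq with h1 | rfl
        · rcases h2.lt_or_eq with h2 | rfl
          · exact hZ y h1 h2
          · exact hx
        · exact hf.1
      rw [propext (lineS_iff_of_ambig_Icc hL hux.le hrun)] at hnA
      by_cases hxt : x < t
      · exact hnA (hA x (by linarith) hxt)
      · exact hno u hru hut fun y h1 h2 => hrun y h1 (by linarith)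
  constructor
  · rintro ⟨t, hrt, hB, hA⟩
    by_cases hZ : Ambig L α β t
    · obtain ⟨z, hz1, hz2, hz3, hz4, hz5⟩ := start t hrt hZ
      refine ⟨z, hz1, Or.inr ⟨hz4, ?_⟩, guard t z hA hz2 fun v h1 h2 h3 =>
        absurd (hz5 v (by linarith) h3) (by linarith)⟩
      rw [← propext hz4.lineS_iff]
      rcases hz2.lt_or_eq with h | h
      · refine Or.inr ⟨hA z hz1 h, t, h, ⟨hZ, ?_⟩, fun u h1 h2 => ⟨hz3 u h1.le h2.le, ?_⟩⟩
        · rwa [propext (lineS_iff_of_ambig_Icc hL hz2 hz3)]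
        · rw [propext (lineS_iff_of_ambig_Icc hL h1.le
            fun w h3 h4 => hz3 w h3 (by linarith))]
          exact hA u (by linarith) h2
      · subst h
        exact Or.inl hB
    · refine ⟨t, hrt, Or.inl ⟨hZ, ?_⟩, guard t t hA le_rfl fun v h1 h2 h3 =>
        hZ (h3 t h2.le le_rfl)⟩
      rwa [← propext (lineS_iff_of_not_ambig hZ)]
  · rintro ⟨t, hrt, hgoal, hguard⟩
    have hA : ∀ u, r < u → u < t → A (LineS α β u) u := by
      intro u hru hut
      by_cases hZ : Ambig L α β u
      · obtain ⟨z, hz1, hz2, hz3, hz4, -⟩ := start u hru hZ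
        obtain ⟨h1, h2⟩ := (hguard z hz1 (by linarith)).2 hz4
        rw [← propext hz4.lineS_iff] at h1 h2
        rcases hz2.lt_or_eq with h | h
        · rw [← propext (lineS_iff_of_ambig_Icc hL hz2 hz3)]
          by_contra hn
          exact h2 ⟨u, h, ⟨hZ, hn⟩, fun w h3 h4 => hz3 w h3.le h4.le⟩
        · exact h ▸ h1
      · rw [propext (lineS_iff_of_not_ambig hZ)]
        exact (hguard u hru hut).1 hZ
    rcases hgoal with ⟨hZ, hB⟩ | ⟨hf, h⟩
    · rw [← propext (lineS_iff_of_not_ambig hZ)] at hB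
      exact ⟨t, hrt, hB, hA⟩
    · rw [← propext hf.lineS_iff] at h
      rcases h with hB | ⟨hAt, s, hts, ⟨hZs, hB⟩, hrun⟩
      · exact ⟨t, hrt, hB, hA⟩
      · have hZ : ∀ w, t ≤ w → w ≤ s → Ambig L α β w := by
          intro w h1 h2
          rcases h1.lt_or_eq with h1 | rfl
          · rcases h2.lt_or_eq with h2 | rfl
            · exact (hrun w h1 h2).1
            · exact hZs
          · exact hf.1
        refine ⟨s, by linarith, ?_, fun u hru hus => ?_⟩
        · change B (LineS α β s) s
          rwa [← propext (lineS_iff_of_ambig_Icc hL hts.le hZ)]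
        · rcases lt_trichotomy u t with hut | rfl | hut
          · exact hA u hru hut
          · exact hAt
          · rw [← propext (lineS_iff_of_ambig_Icc hL hut.le
              fun w h1 h2 => hZ w h1 (by linarith))]
            exact (hrun u hut hus).2

/-- Elimination of a since under an until. -/
lemma lineU_iff_pull_since {A B : Prop → ℝ → Prop} {r : ℝ} (hL : 0 < L) :
    LineU (fun v => A (LineS α β v) v) (fun v => B (LineS α β v) v) r ↔
      (¬ LineU (Ambig L α β) (Ambig L α β) r ∧
        LineU (RunGuard L α β A) (RunGoal L α β A B) r) ∨
      LineU (fun w => Ambig L α β w ∧ A (LineS α β r) w)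
        (fun w => Ambig L α β w ∧ (B (LineS α β r) w ∨ (A (LineS α β r) w ∧
          ¬ LineU (Ambig L α β) (Ambig L α β) w ∧
          LineU (RunGuard L α β A) (RunGoal L α β A B) w))) r := by
  have const : ∀ v, r < v → (∀ w, r < w → w ≤ v → Ambig L α β w) →
      LineS α β r = LineS α β v := fun v hrv h =>
    propext (lineS_iff_of_ambig_Icc hL hrv.le fun w h1 h2 => by
      rcases h1.lt_or_eq with h1 | rfl
      · exact h w h1 h2
      · exact ambig_of_Ioc hrv h)
  constructor
  · intro hU
    by_cases hr : LineU (Ambig L α β) (Ambig L α β) r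
    · obtain ⟨t, hrt, hB, hA⟩ := hU
      obtain ⟨v, hrv, hv, hrun⟩ := hr
      have hv' : ∀ x, r < x → x ≤ v → Ambig L α β x := fun x h1 h2 => by
        rcases h2.lt_or_eq with h2 | rfl
        exacts [hrun x h1 h2, hv]
      right
      by_cases hZ : ∀ x, r < x → x ≤ t → Ambig L α β x
      · refine ⟨t, hrt, ⟨hZ t hrt le_rfl, Or.inl ?_⟩, fun u h1 h2 => ⟨hZ u h1 h2.le, ?_⟩⟩
        · rwa [const t hrt hZ]
        · rw [const u h1 fun w h3 h4 => hZ w h3 (by linarith)]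
          exact hA u h1 h2
      · push Not at hZ
        obtain ⟨w, hrw, hwt, hnw⟩ := hZ
        obtain ⟨y, hry, hyw, hy, hny⟩ := exists_run_end hrv hv' hrw hnw
        have hA' : ∀ u, r < u → u ≤ y → A (LineS α β r) u := fun u h1 h2 => by
          rw [const u h1 fun w h3 h4 => hy w h3 (by linarith)]
          exact hA u h1 (by linarith)
        refine ⟨y, hry, ⟨hy y hry le_rfl, Or.inr ⟨hA' y hry le_rfl, hny, ?_⟩⟩,
          fun u h1 h2 => ⟨hy u h1 h2.le, hA' u h1 h2.le⟩⟩
        rw [← lineU_iff_of_no_run hL hny]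
        exact ⟨t, by linarith, hB, fun u h1 h2 => hA u (by linarith) h2⟩
    · exact Or.inl ⟨hr, (lineU_iff_of_no_run hL hr).1 hU⟩
  · rintro (⟨hr, hU⟩ | ⟨t, hrt, ⟨hZt, h⟩, hrun⟩)
    · exact (lineU_iff_of_no_run hL hr).2 hU
    · have hZ : ∀ x, r < x → x ≤ t → Ambig L α β x := fun x h1 h2 => by
        rcases h2.lt_or_eq with h2 | rfl
        exacts [(hrun x h1 h2).1, hZt]
      have hA : ∀ u, r < u → u < t → A (LineS α β u) u := fun u h1 h2 => by
        rw [← const u h1 fun w h3 h4 => hZ w h3 (by linarith)]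
        exact (hrun u h1 h2).2
      rw [const t hrt hZ] at h
      rcases h with hB | ⟨hAt, hnt, hU⟩
      · exact ⟨t, hrt, hB, hA⟩
      · obtain ⟨s, hts, hB, hAs⟩ := (lineU_iff_of_no_run hL hnt).2 hU
        refine ⟨s, by linarith, hB, fun u h1 h2 => ?_⟩
        rcases lt_trichotomy u t with hut | rfl | hut
        · exact hA u h1 hut
        · exact hAt
        · exact hAs u hut h2

end Line

/-- A semantic property of a signal at a point. -/
abbrev Pred (P : Type) : Type := (ℝ → Set P) → ℝ → Prop

/-- The property defined by a formula. -/
def MTL.den (φ : MTL K P) : Pred P := fun f r => φ.sat f r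

namespace Pred

/-- Conjunction of properties. -/
def and (X Y : Pred P) : Pred P := fun f r => X f r ∧ Y f r

/-- Negation of a property. -/
def not (X : Pred P) : Pred P := fun f r => ¬ X f r

/-- Until on properties. -/
def untl (X Y : Pred P) (I : MTLI K) : Pred P := fun f r =>
  ∃ t : ℝ, r < t ∧ I.mem (t - r) ∧ Y f t ∧ ∀ u, r < u → u < t → X f u

/-- Since on properties. -/
def sinc (X Y : Pred P) (I : MTLI K) : Pred P := fun f r =>
  ∃ t : ℝ, t < r ∧ I.mem (r - t) ∧ Y f t ∧ ∀ u, t < u → u < r → X f u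

/-- Reflection of the time axis. -/
def mirror (X : Pred P) : Pred P := fun f r => X (fun s => f (-s)) (-r)

lemma mirror_mirror (X : Pred P) : X.mirror.mirror = X := by
  funext f r
  simp [mirror]

lemma mirror_untl (X Y : Pred P) (I : MTLI K) :
    (untl X Y I).mirror = sinc X.mirror Y.mirror I := by
  funext f r
  apply propext
  constructor
  · rintro ⟨t, h1, h2, h3, h4⟩
    refine ⟨-t, by linarith, by rwa [sub_neg_eq_add, add_comm, ← sub_neg_eq_add], ?_, ?_⟩
    · simpa [mirror] using h3
    · intro u h5 h6
      exact h4 (-u) (by linarith) (by linarith)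
  · rintro ⟨t, h1, h2, h3, h4⟩
    refine ⟨-t, by linarith, by rwa [neg_sub_neg], h3, fun u h5 h6 => ?_⟩
    have := h4 (-u) (by linarith) (by linarith)
    simpa [mirror] using this

lemma mirror_sinc (X Y : Pred P) (I : MTLI K) :
    (sinc X Y I).mirror = untl X.mirror Y.mirror I := by
  rw [← mirror_mirror (untl X.mirror Y.mirror I), mirror_untl, mirror_mirror, mirror_mirror]

end Pred

namespace MTLI

lemma mem_single {N : ℝ} (hm : N ∈ K) (h0 : 0 < N) (t : ℝ) :
    (single N hm h0).mem t ↔ t = N := by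
  simp only [mem, single, if_true, Option.some.injEq]
  exact ⟨fun h => le_antisymm (h.2 N rfl) h.1, fun h => ⟨h.ge, fun _ h' => h' ▸ h.le⟩⟩

lemma mem_full (t : ℝ) : (full (K := K)).mem t ↔ 0 < t := by
  simp [mem, full]

/-- The open interval `(0, L)`. -/
def oo (L : ℝ) (hm : L ∈ K) (h0 : 0 ≤ L) : MTLI K where
  lo := 0
  lo_mem := zero_mem K
  lo_nonneg := le_refl 0
  loClosed := false
  hi := some L
  hi_mem := fun h hh => by
    obtain rfl := Option.some.inj hh
    exact ⟨hm, h0⟩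
  hiClosed := false
  pos := fun _ => rfl

lemma mem_oo {L : ℝ} (hm : L ∈ K) (h0 : 0 ≤ L) (t : ℝ) :
    (oo L hm h0).mem t ↔ 0 < t ∧ t < L := by
  simp [mem, oo]

lemma bounded_single {N : ℝ} (hm : N ∈ K) (h0 : 0 < N) : (single N hm h0).Bounded := by
  simp [Bounded, single]

lemma bounded_oo {L : ℝ} (hm : L ∈ K) (h0 : 0 ≤ L) : (oo L hm h0).Bounded := by
  simp [Bounded, oo]

lemma Bounded.exists_le {I : MTLI K} (hI : I.Bounded) :
    ∃ m : ℝ, 0 ≤ m ∧ ∀ t, I.mem t → t ≤ m := by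
  obtain ⟨m, hm⟩ := Option.ne_none_iff_exists'.1 hI
  refine ⟨m, (I.hi_mem m hm).2, fun t ht => ?_⟩
  have := ht.2 m hm
  split_ifs at this
  exacts [this, this.le]

end MTLI

/-- Two until properties agree at a point when their arguments agree nearby. -/
lemma untl_iff_of_near {X X' Y Y' : Pred P} {I : MTLI K} {m : ℝ} (hm : ∀ t, I.mem t → t ≤ m)
    {f : ℝ → Set P} {r : ℝ} (hX : ∀ t, |t - r| ≤ m → (X f t ↔ X' f t))
    (hY : ∀ t, |t - r| ≤ m → (Y f t ↔ Y' f t)) :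
    Pred.untl X Y I f r ↔ Pred.untl X' Y' I f r := by
  refine exists_congr fun t => and_congr_right fun h1 => and_congr_right fun h2 => ?_
  have := hm _ h2
  refine and_congr (hY t ?_) (forall_congr' fun u => forall_congr' fun h3 =>
    forall_congr' fun h4 => hX u ?_) <;>
  · rw [abs_le]; constructor <;> linarith

/-- Two since properties agree at a point when their arguments agree nearby. -/
lemma sinc_iff_of_near {X X' Y Y' : Pred P} {I : MTLI K} {m : ℝ} (hm : ∀ t, I.mem t → t ≤ m)
    {f : ℝ → Set P} {r : ℝ} (hX : ∀ t, |t - r| ≤ m → (X f t ↔ X' f t))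
    (hY : ∀ t, |t - r| ≤ m → (Y f t ↔ Y' f t)) :
    Pred.sinc X Y I f r ↔ Pred.sinc X' Y' I f r := by
  refine exists_congr fun t => and_congr_right fun h1 => and_congr_right fun h2 => ?_
  have := hm _ h2
  refine and_congr (hY t ?_) (forall_congr' fun u => forall_congr' fun h3 =>
    forall_congr' fun h4 => hX u ?_) <;>
  · rw [abs_le]; constructor <;> linarith

/-- Classes of properties containing the atoms and closed under the boolean connectives and the
bounded temporal operators. -/
structure Stable (K : AddSubgroup ℝ) (C : Set (Pred P)) : Prop where
  tt : (fun _ _ => True) ∈ C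
  atom (p : P) : (fun f r => p ∈ f r) ∈ C
  and {X Y : Pred P} : X ∈ C → Y ∈ C → X.and Y ∈ C
  not {X : Pred P} : X ∈ C → X.not ∈ C
  untl {X Y : Pred P} (I : MTLI K) : I.Bounded → X ∈ C → Y ∈ C → X.untl Y I ∈ C
  sinc {X Y : Pred P} (I : MTLI K) : I.Bounded → X ∈ C → Y ∈ C → X.sinc Y I ∈ C

namespace Stable

variable {C : Set (Pred P)}

lemma or' (hC : Stable K C) {X Y : Pred P} (hX : X ∈ C) (hY : Y ∈ C) :
    (fun f r => X f r ∨ Y f r) ∈ C := by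
  convert hC.not (hC.and (hC.not hX) (hC.not hY)) using 1
  funext f r
  simp only [Pred.not, Pred.and, eq_iff_iff]
  tauto

lemma imp (hC : Stable K C) {X Y : Pred P} (hX : X ∈ C) (hY : Y ∈ C) :
    (fun f r => X f r → Y f r) ∈ C := by
  convert hC.or' (hC.not hX) hY using 1
  funext f r
  simp only [Pred.not, eq_iff_iff]
  tauto

lemma const (hC : Stable K C) (b : Prop) : (fun _ _ => b) ∈ C := by
  by_cases hb : b
  · simpa [hb] using hC.tt
  · convert hC.not hC.tt using 1
    funext f r
    simp [Pred.not, hb]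

/-- Case distinction on a property in the class. -/
lemma subst (hC : Stable K C) {E : Pred P} (hE : E ∈ C) {X : Prop → Pred P}
    (hX : ∀ b, X b ∈ C) : (fun f r => X (E f r) f r) ∈ C := by
  convert hC.or' (hC.and hE (hX True)) (hC.and (hC.not hE) (hX False)) using 1
  funext f r
  by_cases h : E f r <;> simp [Pred.and, Pred.not, h]

lemma shift_past (hC : Stable K C) {X : Pred P} (hX : X ∈ C) {N : ℝ} (hm : N ∈ K)
    (h0 : 0 < N) : (fun f r => X f (r - N)) ∈ C := by
  convert hC.sinc (MTLI.single N hm h0) (MTLI.bounded_single hm h0) hC.tt hX using 1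
  funext f r
  simp only [Pred.sinc, MTLI.mem_single, eq_iff_iff]
  constructor
  · exact fun h => ⟨r - N, by linarith, by ring, h, fun _ _ _ => trivial⟩
  · rintro ⟨t, -, h, hX, -⟩
    rwa [← h, sub_sub_cancel]

lemma shift_future (hC : Stable K C) {X : Pred P} (hX : X ∈ C) {N : ℝ} (hm : N ∈ K)
    (h0 : 0 < N) : (fun f r => X f (r + N)) ∈ C := by
  convert hC.untl (MTLI.single N hm h0) (MTLI.bounded_single hm h0) hC.tt hX using 1
  funext f r
  simp only [Pred.untl, MTLI.mem_single, eq_iff_iff]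
  constructor
  · exact fun h => ⟨r + N, by linarith, by ring, h, fun _ _ _ => trivial⟩
  · rintro ⟨t, -, h, hX, -⟩
    rwa [← h, add_sub_cancel]

lemma lineSB (hC : Stable K C) {X Y : Pred P} (hX : X ∈ C) (hY : Y ∈ C) {L : ℝ} (hm : L ∈ K)
    (h0 : 0 < L) : (fun f r => LineSB L (X f) (Y f) r) ∈ C := by
  convert hC.sinc (MTLI.oo L hm h0.le) (MTLI.bounded_oo hm h0.le) hX hY using 1
  funext f r
  simp only [Pred.sinc, MTLI.mem_oo, LineSB, sub_pos, eq_iff_iff]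
  refine exists_congr fun t => ?_
  tauto

lemma lineUB (hC : Stable K C) {X Y : Pred P} (hX : X ∈ C) (hY : Y ∈ C) {L : ℝ} (hm : L ∈ K)
    (h0 : 0 < L) : (fun f r => LineUB L (X f) (Y f) r) ∈ C := by
  convert hC.untl (MTLI.oo L hm h0.le) (MTLI.bounded_oo hm h0.le) hX hY using 1
  funext f r
  simp only [Pred.untl, MTLI.mem_oo, LineUB, sub_pos, eq_iff_iff]
  refine exists_congr fun t => ?_
  tauto

lemma exists_past (hC : Stable K C) {X : Pred P} (hX : X ∈ C) {L : ℝ} (hm : L ∈ K)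
    (h0 : 0 < L) : (fun f r => ∃ u, u < r ∧ r - u < L ∧ X f u) ∈ C := by
  convert hC.lineSB hC.tt hX hm h0 using 1
  funext f r
  simp [LineSB]

lemma forall_past (hC : Stable K C) {X : Pred P} (hX : X ∈ C) {L : ℝ} (hm : L ∈ K)
    (h0 : 0 < L) : (fun f r => ∀ u, u < r → r - u < L → X f u) ∈ C := by
  convert hC.not (hC.exists_past (hC.not hX) hm h0) using 1
  funext f r
  simp [Pred.not]

lemma forall_future (hC : Stable K C) {X : Pred P} (hX : X ∈ C) {L : ℝ} (hm : L ∈ K)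
    (h0 : 0 < L) : (fun f r => ∀ u, r < u → u - r < L → X f u) ∈ C := by
  convert hC.not (hC.lineUB hC.tt (hC.not hX) hm h0) using 1
  funext f r
  simp [Pred.not, LineUB]

lemma ambig (hC : Stable K C) {X Y : Pred P} (hX : X ∈ C) (hY : Y ∈ C) {L : ℝ} (hm : L ∈ K)
    (h0 : 0 < L) : (fun f r => Ambig L (X f) (Y f) r) ∈ C :=
  hC.forall_past (hC.and hX (hC.not hY)) hm h0

lemma fresh (hC : Stable K C) {X Y : Pred P} (hX : X ∈ C) (hY : Y ∈ C) {L : ℝ} (hm : L ∈ K)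
    (h0 : 0 < L) : (fun f r => Fresh L (X f) (Y f) r) ∈ C :=
  hC.and (hC.ambig hX hY hm h0) (hC.exists_past (hC.not (hC.ambig hX hY hm h0)) hm h0)

lemma entry (hC : Stable K C) {X Y : Pred P} (hX : X ∈ C) (hY : Y ∈ C) {L : ℝ} (hm : L ∈ K)
    (h0 : 0 < L) : (fun f r => Entry L (X f) (Y f) r) ∈ C :=
  hC.exists_past (hC.lineSB hX hY hm h0) hm h0

end Stable

lemma untl_full_eq (X Y : Pred P) :
    X.untl Y (MTLI.full (K := K)) = fun f r => LineU (X f) (Y f) r := by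
  funext f r
  simp only [Pred.untl, MTLI.mem_full, LineU, sub_pos, eq_iff_iff]
  refine exists_congr fun t => ?_
  tauto

lemma sinc_full_eq (X Y : Pred P) :
    X.sinc Y (MTLI.full (K := K)) = fun f r => LineS (X f) (Y f) r := by
  funext f r
  simp only [Pred.sinc, MTLI.mem_full, LineS, sub_pos, eq_iff_iff]
  refine exists_congr fun t => ?_
  tauto

/-- Closure under the unconstrained until operator. -/
def UntilClosed (C : Set (Pred P)) : Prop :=
  ∀ X ∈ C, ∀ Y ∈ C, (fun f r => LineU (X f) (Y f) r) ∈ C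

/-- Closure under until with an arbitrary interval follows from the bounded and the unconstrained
case. -/
lemma Stable.untl_mem {C : Set (Pred P)} (hC : Stable K C) (hU : UntilClosed C) {X Y : Pred P}
    (hX : X ∈ C) (hY : Y ∈ C) (I : MTLI K) : X.untl Y I ∈ C := by
  by_cases hI : I.Bounded
  · exact hC.untl I hI hX hY
  have hhi : I.hi = none := by simpa [MTLI.Bounded] using hI
  rcases I.lo_nonneg.eq_or_lt with h0 | h0
  · convert hU X hX Y hY using 1
    funext f r
    simp only [Pred.untl, MTLI.mem, I.pos h0.symm, hhi, ← h0, LineU, sub_pos, eq_iff_iff]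
    refine exists_congr fun t => ?_
    simp
  have hbase := hC.forall_future hX I.lo_mem h0
  have hgoal := hC.and hX (hU X hX Y hY)
  have split : ∀ f r, X.untl Y I f r ↔ (∀ u, r < u → u - r < I.lo → X f u) ∧
      ((I.loClosed = true ∧ Y f (r + I.lo)) ∨
        (X f (r + I.lo) ∧ LineU (X f) (Y f) (r + I.lo))) := by
    intro f r
    constructor
    · rintro ⟨t, h1, h2, h3, h4⟩
      have h2 := h2.1
      have hle : r + I.lo ≤ t := by split_ifs at h2 <;> linarith
      refine ⟨fun u h5 h6 => h4 u h5 (by linarith), ?_⟩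
      rcases hle.eq_or_lt with h | h
      · left
        subst h
        refine ⟨?_, h3⟩
        by_contra hc
        simp [hc] at h2
      · exact Or.inr ⟨h4 _ (by linarith) h, t, h, h3, fun u h5 h6 => h4 u (by linarith) h6⟩
    · rintro ⟨h1, ⟨h2, h3⟩ | ⟨h2, t, h3, h4, h5⟩⟩
      · refine ⟨r + I.lo, by linarith, ?_, h3, fun u h4 h5 => h1 u h4 (by linarith)⟩
        simp [MTLI.mem, hhi, h2]
      · refine ⟨t, by linarith, ⟨?_, by simp [hhi]⟩, h4, fun u h6 h7 => ?_⟩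
        · split_ifs <;> linarith
        · rcases lt_trichotomy u (r + I.lo) with h | rfl | h
          · exact h1 u h6 (by linarith)
          · exact h2
          · exact h5 u h h7
  rw [show X.untl Y I = _ from funext fun f => funext fun r => propext (split f r)]
  exact hC.and hbase (hC.or' (hC.and (hC.const _) (hC.shift_future hY I.lo_mem h0))
    (hC.shift_future hgoal I.lo_mem h0))

/-- An until over arguments that mention the since `α S β` is a boolean combination of that
since and of members of the class. -/
lemma Stable.pull_since {C D : Set (Pred P)} (hC : Stable K C) (hU : UntilClosed C)
    (hD : Stable K D) (hCD : C ⊆ D) {L : ℝ} (hm : L ∈ K) (hL : 0 < L) {α β : Pred P}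
    (hα : α ∈ C) (hβ : β ∈ C) (hσ : (fun f r => LineS (α f) (β f) r) ∈ D)
    {A B : Prop → Pred P} (hA : ∀ b, A b ∈ C) (hB : ∀ b, B b ∈ C) :
    (fun f r => LineU (fun v => A (LineS (α f) (β f) v) f v)
      (fun v => B (LineS (α f) (β f) v) f v) r) ∈ D := by
  have hZ := hC.ambig hα hβ hm hL
  have hb := hC.lineSB hα hβ hm hL
  have hF := hC.fresh hα hβ hm hL
  have hE := hC.entry hα hβ hm hL
  have hG : (fun f v => RunGuard L (α f) (β f) (fun b => A b f) v) ∈ C :=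
    hC.and (hC.imp (hC.not hZ) (hC.subst hb hA)) (hC.imp hF (hC.subst hE
      (X := fun b f v => A b f v ∧
        ¬ LineU (Ambig L (α f) (β f)) (fun w => Ambig L (α f) (β f) w ∧ ¬ A b f w) v)
      fun b => hC.and (hA b) (hC.not (hU _ hZ _ (hC.and hZ (hC.not (hA b)))))))
  have hH : (fun f v => RunGoal L (α f) (β f) (fun b => A b f) (fun b => B b f) v) ∈ C :=
    hC.or' (hC.and (hC.not hZ) (hC.subst hb hB)) (hC.and hF (hC.subst hE
      (X := fun b f v => B b f v ∨ (A b f v ∧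
        LineU (fun w => Ambig L (α f) (β f) w ∧ A b f w)
          (fun w => Ambig L (α f) (β f) w ∧ B b f w) v))
      fun b => hC.or' (hB b) (hC.and (hA b) (hU _ (hC.and hZ (hA b)) _ (hC.and hZ (hB b))))))
  have hT := hU _ hG _ hH
  have hρ := hC.not (hU _ hZ _ hZ)
  have hsum := hD.or' (hCD (hC.and hρ hT)) (hD.subst hσ
    (X := fun b f r => LineU (fun w => Ambig L (α f) (β f) w ∧ A b f w)
        (fun w => Ambig L (α f) (β f) w ∧ (B b f w ∨ (A b f w ∧
          ¬ LineU (Ambig L (α f) (β f)) (Ambig L (α f) (β f)) w ∧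
          LineU (RunGuard L (α f) (β f) fun b => A b f)
            (RunGoal L (α f) (β f) (fun b => A b f) fun b => B b f) w))) r)
    fun b => hCD (hU _ (hC.and hZ (hA b)) _
      (hC.and hZ (hC.or' (hB b) (hC.and (hA b) (hC.and hρ hT))))))
  convert hsum using 1
  funext f r
  exact propext (lineU_iff_pull_since (A := fun b => A b f) (B := fun b => B b f) hL)

/-- The properties obtained from `G` and the atoms by boolean connectives and bounded temporal
operators, together with the unconstrained until if `u` and the unconstrained since if `s`. -/
inductive Gen (K : AddSubgroup ℝ) (u s : Prop) (G : Set (Pred P)) : Pred P → Prop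
  | base {X : Pred P} : X ∈ G → Gen K u s G X
  | tt : Gen K u s G (fun _ _ => True)
  | atom (p : P) : Gen K u s G (fun f r => p ∈ f r)
  | and {X Y : Pred P} : Gen K u s G X → Gen K u s G Y → Gen K u s G (X.and Y)
  | not {X : Pred P} : Gen K u s G X → Gen K u s G X.not
  | untl {X Y : Pred P} (I : MTLI K) : I.Bounded ∨ (u ∧ I = MTLI.full) →
      Gen K u s G X → Gen K u s G Y → Gen K u s G (X.untl Y I)
  | sinc {X Y : Pred P} (I : MTLI K) : I.Bounded ∨ (s ∧ I = MTLI.full) →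
      Gen K u s G X → Gen K u s G Y → Gen K u s G (X.sinc Y I)

lemma stable_gen (u s : Prop) (G : Set (Pred P)) : Stable K {X | Gen K u s G X} where
  tt := .tt
  atom := .atom
  and := .and
  not := .not
  untl I hI := .untl I (Or.inl hI)
  sinc I hI := .sinc I (Or.inl hI)

lemma Gen.mem_of_stable {G C : Set (Pred P)} (hC : Stable K C) (hG : G ⊆ C) {X : Pred P}
    (hX : Gen K False False G X) : X ∈ C := by
  induction hX with
  | base h => exact hG h
  | tt => exact hC.tt
  | atom p => exact hC.atom p
  | and _ _ h1 h2 => exact hC.and h1 h2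
  | not _ h => exact hC.not h
  | untl I hI _ _ h1 h2 => exact hC.untl I (hI.resolve_right fun h => h.1) h1 h2
  | sinc I hI _ _ h1 h2 => exact hC.sinc I (hI.resolve_right fun h => h.1) h1 h2

lemma Gen.mirror {u s : Prop} {G H : Set (Pred P)} (hG : ∀ X ∈ G, X.mirror ∈ H) {X : Pred P}
    (hX : Gen K u s G X) : Gen K s u H X.mirror := by
  induction hX with
  | base h => exact .base (hG _ h)
  | tt => exact .tt
  | atom p =>
    convert Gen.atom p using 1
    funext f r
    simp [Pred.mirror]
  | and _ _ h1 h2 => exact .and h1 h2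
  | not _ h => exact .not h
  | untl I hI _ _ h1 h2 => exact Pred.mirror_untl _ _ I ▸ .sinc I hI h1 h2
  | sinc I hI _ _ h1 h2 => exact Pred.mirror_sinc _ _ I ▸ .untl I hI h1 h2

/-- Properties without unbounded since or without unbounded until. -/
def OneSided (K : AddSubgroup ℝ) (P : Type) : Set (Pred P) :=
  {X | Gen K True False ∅ X ∨ Gen K False True ∅ X}

/-- Properties in which unbounded until and unbounded since are not nested in each other. -/
def Separated (K : AddSubgroup ℝ) (P : Type) : Set (Pred P) :=
  {X | Gen K False False (OneSided K P) X}

lemma stable_separated : Stable K (Separated K P) := stable_gen False False _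

lemma mirror_mem_separated {X : Pred P} (hX : X ∈ Separated K P) :
    X.mirror ∈ Separated K P := by
  refine Gen.mirror (fun Y hY => ?_) hX
  rcases hY with hY | hY
  · exact Or.inr (hY.mirror fun _ h => h.elim)
  · exact Or.inl (hY.mirror fun _ h => h.elim)

lemma exists_mem_gt (hnt : K ≠ ⊥) (x : ℝ) : ∃ N ∈ K, 0 < N ∧ x < N := by
  obtain ⟨⟨a, ha⟩, h0⟩ := AddSubgroup.ne_bot_iff_exists_ne_zero.1 hnt
  have ha0 : a ≠ 0 := fun h => h0 (Subtype.ext h)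
  have hb : |a| ∈ K := by
    rcases abs_choice a with h | h <;> rw [h]
    exacts [ha, neg_mem ha]
  have hpos : 0 < |a| := abs_pos.2 ha0
  obtain ⟨n, hn⟩ := Archimedean.arch (max x 1) hpos
  refine ⟨(n + 1) • |a|, nsmul_mem hb _, by positivity, ?_⟩
  rw [succ_nsmul]
  linarith [le_max_left x 1]

lemma lineS_shift (α β : ℝ → Prop) (N r : ℝ) :
    LineS (fun t => α (t - N)) (fun t => β (t - N)) r ↔ LineS α β (r - N) := by
  constructor
  · rintro ⟨t, h1, h2, h3⟩
    refine ⟨t - N, by linarith, h2, fun u h4 h5 => ?_⟩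
    have : α (u + N - N) := h3 (u + N) (by linarith) (by linarith)
    rwa [add_sub_cancel_right] at this
  · rintro ⟨t, h1, h2, h3⟩
    refine ⟨t + N, by linarith, by simpa only [add_sub_cancel_right] using h2, fun u h4 h5 => ?_⟩
    exact h3 (u - N) (by linarith) (by linarith)

lemma abs_sub_le_add {a b d M m : ℝ} (h1 : |a - b| ≤ m) (h2 : |b - d| ≤ M) :
    |a - d| ≤ M + m := by
  linarith [abs_sub_le a b d]

/-- In a bounded window, a bounded combination of a since and of a stable class depends on the
since only through its value at one earlier point. -/
lemma Stable.exists_subst (hnt : K ≠ ⊥) {C : Set (Pred P)} (hC : Stable K C) {α β : Pred P}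
    (hα : α ∈ C) (hβ : β ∈ C) {X : Pred P}
    (hX : Gen K False False (insert (fun f r => LineS (α f) (β f) r) C) X) :
    ∀ M : ℝ, ∃ N₀ : ℝ, ∀ N ∈ K, N₀ < N → ∃ A : Prop → Pred P, (∀ b, A b ∈ C) ∧
      ∀ f r t, |t - r| ≤ M → (X f t ↔ A (LineS (α f) (β f) (r - N)) f t) := by
  have const : ∀ X ∈ C, ∀ M : ℝ, ∃ N₀ : ℝ, ∀ N ∈ K, N₀ < N → ∃ A : Prop → Pred P,
      (∀ b, A b ∈ C) ∧ ∀ f r t, |t - r| ≤ M → (X f t ↔ A (LineS (α f) (β f) (r - N)) f t) :=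
    fun X h M => ⟨0, fun N _ _ => ⟨fun _ => X, fun _ => h, fun _ _ _ _ => Iff.rfl⟩⟩
  induction hX with
  | base h =>
    rcases h with rfl | h
    · intro M
      refine ⟨M, fun N _ hN => ?_⟩
      obtain ⟨L, hm, hL0, hL⟩ := exists_mem_gt hnt (N + M)
      refine ⟨fun b f t => LineSB L (α f) (β f) t ∨ ((∀ u, u < t → t - u < L → α f u) ∧ b),
        fun b => hC.or' (hC.lineSB hα hβ hm hL0)
          (hC.and (hC.forall_past hα hm hL0) (hC.const b)), fun f r t ht => ?_⟩
      rw [abs_le] at ht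
      exact lineS_iff_of_far (by linarith) (by linarith)
    · exact const _ h
  | tt => exact const _ hC.tt
  | atom p => exact const _ (hC.atom p)
  | and _ _ h1 h2 =>
    intro M
    obtain ⟨N₁, h1⟩ := h1 M
    obtain ⟨N₂, h2⟩ := h2 M
    refine ⟨max N₁ N₂, fun N hm hN => ?_⟩
    obtain ⟨A, hA, h1⟩ := h1 N hm ((le_max_left _ _).trans_lt hN)
    obtain ⟨B, hB, h2⟩ := h2 N hm ((le_max_right _ _).trans_lt hN)
    exact ⟨fun b => (A b).and (B b), fun b => hC.and (hA b) (hB b),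
      fun f r t ht => and_congr (h1 f r t ht) (h2 f r t ht)⟩
  | not _ h =>
    intro M
    obtain ⟨N₀, h⟩ := h M
    refine ⟨N₀, fun N hm hN => ?_⟩
    obtain ⟨A, hA, h⟩ := h N hm hN
    exact ⟨fun b => (A b).not, fun b => hC.not (hA b), fun f r t ht => not_congr (h f r t ht)⟩
  | untl I hI _ _ h1 h2 =>
    intro M
    have hI := hI.resolve_right fun h => h.1
    obtain ⟨m, -, hle⟩ := hI.exists_le
    obtain ⟨N₁, h1⟩ := h1 (M + m)
    obtain ⟨N₂, h2⟩ := h2 (M + m)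
    refine ⟨max N₁ N₂, fun N hm hN => ?_⟩
    obtain ⟨A, hA, h1⟩ := h1 N hm ((le_max_left _ _).trans_lt hN)
    obtain ⟨B, hB, h2⟩ := h2 N hm ((le_max_right _ _).trans_lt hN)
    exact ⟨fun b => (A b).untl (B b) I, fun b => hC.untl I hI (hA b) (hB b), fun f r t ht =>
      untl_iff_of_near hle (fun v hv => h1 f r v (abs_sub_le_add hv ht))
        fun v hv => h2 f r v (abs_sub_le_add hv ht)⟩
  | sinc I hI _ _ h1 h2 =>
    intro M
    have hI := hI.resolve_right fun h => h.1
    obtain ⟨m, -, hle⟩ := hI.exists_le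
    obtain ⟨N₁, h1⟩ := h1 (M + m)
    obtain ⟨N₂, h2⟩ := h2 (M + m)
    refine ⟨max N₁ N₂, fun N hm hN => ?_⟩
    obtain ⟨A, hA, h1⟩ := h1 N hm ((le_max_left _ _).trans_lt hN)
    obtain ⟨B, hB, h2⟩ := h2 N hm ((le_max_right _ _).trans_lt hN)
    exact ⟨fun b => (A b).sinc (B b) I, fun b => hC.sinc I hI (hA b) (hB b), fun f r t ht =>
      sinc_iff_of_near hle (fun v hv => h1 f r v (abs_sub_le_add hv ht))
        fun v hv => h2 f r v (abs_sub_le_add hv ht)⟩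

/-- Adjoining a since to a stable until-closed class preserves closure under until. -/
lemma Stable.untilClosed_insert (hnt : K ≠ ⊥) {C : Set (Pred P)} (hC : Stable K C)
    (hU : UntilClosed C) {α β : Pred P} (hα : α ∈ C) (hβ : β ∈ C) :
    UntilClosed {X | Gen K False False (insert (fun f r => LineS (α f) (β f) r) C) X} := by
  intro X hX Y hY
  have hD := stable_gen (K := K) False False (insert (fun f r => LineS (α f) (β f) r) C)
  obtain ⟨N₁, h1⟩ := hC.exists_subst hnt hα hβ hX 0
  obtain ⟨N₂, h2⟩ := hC.exists_subst hnt hα hβ hY 0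
  obtain ⟨N, hm, hN0, hN⟩ := exists_mem_gt hnt (max N₁ N₂)
  obtain ⟨A, hA, h1⟩ := h1 N hm ((le_max_left _ _).trans_lt hN)
  obtain ⟨B, hB, h2⟩ := h2 N hm ((le_max_right _ _).trans_lt hN)
  have hσ := hD.shift_past (Gen.base (Set.mem_insert _ C)) hm hN0
  simp only [← lineS_shift] at hσ
  have := hC.pull_since hU hD (fun Z hZ => Gen.base (Set.mem_insert_of_mem _ hZ)) hm hN0
    (hC.shift_past hα hm hN0) (hC.shift_past hβ hm hN0) hσ hA hB
  convert this using 4 with f r v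
  · ext v
    rw [lineS_shift]
    exact h1 f v v (by simp)
  · ext v
    rw [lineS_shift]
    exact h2 f v v (by simp)

/-- Stable until-closed classes between the since-free and the separated properties. -/
structure Good (K : AddSubgroup ℝ) (C : Set (Pred P)) : Prop where
  stable : Stable K C
  untilClosed : UntilClosed C
  sinceFree_mem : ∀ X, Gen K True False ∅ X → X ∈ C
  subset : C ⊆ Separated K P

lemma good_sinceFree : Good K {X : Pred P | Gen K True False ∅ X} where
  stable := stable_gen _ _ _
  untilClosed X hX Y hY := by
    rw [← untl_full_eq (K := K)]
    exact Gen.untl _ (Or.inr ⟨trivial, rfl⟩) hX hY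
  sinceFree_mem _ h := h
  subset _ h := Gen.base (Or.inl h)

lemma Good.exists_adjoin (hnt : K ≠ ⊥) {C : Set (Pred P)} (hC : Good K C) {X : Pred P}
    (hX : Gen K False True ∅ X) : ∃ C', C ⊆ C' ∧ Good K C' ∧ X ∈ C' := by
  induction hX generalizing C with
  | base h => exact h.elim
  | tt => exact ⟨C, subset_rfl, hC, hC.stable.tt⟩
  | atom p => exact ⟨C, subset_rfl, hC, hC.stable.atom p⟩
  | and _ _ h1 h2 =>
    obtain ⟨C₁, hs₁, hC₁, h1⟩ := h1 hC
    obtain ⟨C₂, hs₂, hC₂, h2⟩ := h2 hC₁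
    exact ⟨C₂, hs₁.trans hs₂, hC₂, hC₂.stable.and (hs₂ h1) h2⟩
  | not _ h =>
    obtain ⟨C₁, hs₁, hC₁, h⟩ := h hC
    exact ⟨C₁, hs₁, hC₁, hC₁.stable.not h⟩
  | untl I hI _ _ h1 h2 =>
    obtain ⟨C₁, hs₁, hC₁, h1⟩ := h1 hC
    obtain ⟨C₂, hs₂, hC₂, h2⟩ := h2 hC₁
    exact ⟨C₂, hs₁.trans hs₂, hC₂,
      hC₂.stable.untl I (hI.resolve_right fun h => h.1) (hs₂ h1) h2⟩
  | @sinc X Y I hI hX hY h1 h2 =>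
    obtain ⟨C₁, hs₁, hC₁, h1⟩ := h1 hC
    obtain ⟨C₂, hs₂, hC₂, h2⟩ := h2 hC₁
    rcases hI with hI | ⟨-, rfl⟩
    · exact ⟨C₂, hs₁.trans hs₂, hC₂, hC₂.stable.sinc I hI (hs₂ h1) h2⟩
    · have hmem : X.sinc Y (MTLI.full (K := K)) ∈ Separated K P :=
        Gen.base (Or.inr (.sinc _ (Or.inr ⟨trivial, rfl⟩) hX hY))
      rw [sinc_full_eq] at hmem ⊢
      have hle : C₂ ⊆ {Z | Gen K False False (insert (fun f r => LineS (X f) (Y f) r) C₂) Z} :=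
        fun Z hZ => Gen.base (Set.mem_insert_of_mem _ hZ)
      exact ⟨_, (hs₁.trans hs₂).trans hle, ⟨stable_gen _ _ _,
        hC₂.stable.untilClosed_insert hnt hC₂.untilClosed (hs₂ h1) h2,
        fun Z hZ => hle (hC₂.sinceFree_mem Z hZ),
        fun Z hZ => Gen.mem_of_stable stable_separated
          (Set.insert_subset hmem hC₂.subset) hZ⟩, Gen.base (Set.mem_insert _ _)⟩

lemma Good.exists_adjoin_separated (hnt : K ≠ ⊥) {C : Set (Pred P)} (hC : Good K C)
    {X : Pred P} (hX : X ∈ Separated K P) : ∃ C', C ⊆ C' ∧ Good K C' ∧ X ∈ C' := by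
  induction hX generalizing C with
  | base h =>
    rcases h with h | h
    · exact ⟨C, subset_rfl, hC, hC.sinceFree_mem _ h⟩
    · exact hC.exists_adjoin hnt h
  | tt => exact ⟨C, subset_rfl, hC, hC.stable.tt⟩
  | atom p => exact ⟨C, subset_rfl, hC, hC.stable.atom p⟩
  | and _ _ h1 h2 =>
    obtain ⟨C₁, hs₁, hC₁, h1⟩ := h1 hC
    obtain ⟨C₂, hs₂, hC₂, h2⟩ := h2 hC₁
    exact ⟨C₂, hs₁.trans hs₂, hC₂, hC₂.stable.and (hs₂ h1) h2⟩
  | not _ h =>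
    obtain ⟨C₁, hs₁, hC₁, h⟩ := h hC
    exact ⟨C₁, hs₁, hC₁, hC₁.stable.not h⟩
  | untl I hI _ _ h1 h2 =>
    obtain ⟨C₁, hs₁, hC₁, h1⟩ := h1 hC
    obtain ⟨C₂, hs₂, hC₂, h2⟩ := h2 hC₁
    exact ⟨C₂, hs₁.trans hs₂, hC₂,
      hC₂.stable.untl I (hI.resolve_right fun h => h.1) (hs₂ h1) h2⟩
  | sinc I hI _ _ h1 h2 =>
    obtain ⟨C₁, hs₁, hC₁, h1⟩ := h1 hC
    obtain ⟨C₂, hs₂, hC₂, h2⟩ := h2 hC₁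
    exact ⟨C₂, hs₁.trans hs₂, hC₂,
      hC₂.stable.sinc I (hI.resolve_right fun h => h.1) (hs₂ h1) h2⟩

lemma untilClosed_separated (hnt : K ≠ ⊥) : UntilClosed (Separated K P) := by
  intro X hX Y hY
  obtain ⟨C₁, -, hC₁, h1⟩ := good_sinceFree.exists_adjoin_separated hnt hX
  obtain ⟨C₂, hs, hC₂, h2⟩ := hC₁.exists_adjoin_separated hnt hY
  exact hC₂.subset (hC₂.untilClosed X (hs h1) Y h2)

lemma den_mem_separated (hnt : K ≠ ⊥) (φ : MTL K P) : φ.den ∈ Separated K P := by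
  have hS := stable_separated (K := K) (P := P)
  have hU := untilClosed_separated (K := K) (P := P) hnt
  induction φ with
  | tt => exact hS.tt
  | atom p => exact hS.atom p
  | conj φ ψ h1 h2 => exact hS.and h1 h2
  | neg φ h => exact hS.not h
  | untl φ ψ I h1 h2 => exact hS.untl_mem hU h1 h2 I
  | sinc φ ψ I h1 h2 =>
    have := mirror_mem_separated
      (hS.untl_mem hU (mirror_mem_separated h1) (mirror_mem_separated h2) I)
    rwa [Pred.mirror_untl, Pred.mirror_mirror, Pred.mirror_mirror] at this

/-- Reflection of a formula: exchanges until and since. -/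
def MTL.mirror : MTL K P → MTL K P
  | tt => tt
  | atom p => atom p
  | conj φ ψ => conj φ.mirror ψ.mirror
  | neg φ => neg φ.mirror
  | untl φ ψ I => sinc φ.mirror ψ.mirror I
  | sinc φ ψ I => untl φ.mirror ψ.mirror I

namespace MTL

lemma den_mirror (φ : MTL K P) : φ.mirror.den = φ.den.mirror := by
  induction φ with
  | tt => rfl
  | atom p =>
    funext f r
    simp [den, Pred.mirror, sat, mirror]
  | conj φ ψ h1 h2 =>
    change φ.mirror.den.and ψ.mirror.den = _
    rw [h1, h2]
    rfl
  | neg φ h =>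
    change φ.mirror.den.not = _
    rw [h]
    rfl
  | untl φ ψ I h1 h2 =>
    change φ.mirror.den.sinc ψ.mirror.den I = (φ.den.untl ψ.den I).mirror
    rw [h1, h2, Pred.mirror_untl]
  | sinc φ ψ I h1 h2 =>
    change φ.mirror.den.untl ψ.mirror.den I = (φ.den.sinc ψ.den I).mirror
    rw [h1, h2, Pred.mirror_sinc]

lemma reach_mirror (φ : MTL K P) : φ.mirror.fr = φ.pr ∧ φ.mirror.pr = φ.fr := by
  induction φ with
  | tt => exact ⟨rfl, rfl⟩
  | atom p => exact ⟨rfl, rfl⟩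
  | conj φ ψ h1 h2 => simp [mirror, fr, pr, h1, h2]
  | neg φ h => simp [mirror, fr, pr, h]
  | untl φ ψ I h1 h2 => simp [mirror, fr, pr, h1, h2]
  | sinc φ ψ I h1 h2 => simp [mirror, fr, pr, h1, h2]

lemma AllBounded.mirror {φ : MTL K P} (h : φ.AllBounded) : φ.mirror.AllBounded := by
  induction φ with
  | tt => trivial
  | atom p => trivial
  | conj φ ψ h1 h2 => exact ⟨h1 h.1, h2 h.2⟩
  | neg φ h1 => exact h1 h
  | untl φ ψ I h1 h2 => exact ⟨h.1, h1 h.2.1, h2 h.2.2⟩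
  | sinc φ ψ I h1 h2 => exact ⟨h.1, h1 h.2.1, h2 h.2.2⟩

end MTL

lemma SepKind.mirror {c : ℝ} {φ : MTL K P} (h : SepKind c φ) : SepKind c φ.mirror := by
  rcases h with ⟨N, hm, h0, θ, rfl, hθ⟩ | ⟨N, hm, h0, θ, rfl, hθ⟩ | h
  · exact Or.inr (Or.inl ⟨N, hm, h0, θ.mirror, rfl, by rwa [θ.reach_mirror.1]⟩)
  · exact Or.inl ⟨N, hm, h0, θ.mirror, rfl, by rwa [θ.reach_mirror.2]⟩
  · exact Or.inr (Or.inr h.mirror)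

/-- Properties defined by boolean combinations of the formulas of the separation lemma. -/
def SepBool (K : AddSubgroup ℝ) (P : Type) (c : ℝ) : Set (Pred P) :=
  {X | ∃ φ : MTL K P, MTL.BC (SepKind c) φ ∧ φ.den = X}

section SepBool

variable {c : ℝ}

lemma and_mem_sepBool {X Y : Pred P} (hX : X ∈ SepBool K P c) (hY : Y ∈ SepBool K P c) :
    X.and Y ∈ SepBool K P c := by
  obtain ⟨φ, hφ, rfl⟩ := hX
  obtain ⟨ψ, hψ, rfl⟩ := hY
  exact ⟨φ.conj ψ, hφ.conjB hψ, rfl⟩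

lemma not_mem_sepBool {X : Pred P} (hX : X ∈ SepBool K P c) : X.not ∈ SepBool K P c := by
  obtain ⟨φ, hφ, rfl⟩ := hX
  exact ⟨φ.neg, hφ.negB, rfl⟩

lemma mirror_mem_sepBool {X : Pred P} (hX : X ∈ SepBool K P c) :
    X.mirror ∈ SepBool K P c := by
  obtain ⟨φ, hφ, rfl⟩ := hX
  refine ⟨φ.mirror, ?_, φ.den_mirror⟩
  induction hφ with
  | base h => exact .base h.mirror
  | negB _ h => exact .negB h
  | conjB _ _ h1 h2 => exact .conjB h1 h2

lemma tt_mem_sepBool : (fun _ _ => True) ∈ SepBool K P c :=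
  ⟨.tt, .base (Or.inr (Or.inr trivial)), rfl⟩

lemma Gen.mem_sepBool {X : Pred P} (hX : Gen K False False ∅ X) : X ∈ SepBool K P c := by
  suffices h : ∃ φ : MTL K P, φ.AllBounded ∧ φ.den = X by
    obtain ⟨φ, hφ, h⟩ := h
    exact ⟨φ, .base (Or.inr (Or.inr hφ)), h⟩
  induction hX with
  | base h => exact h.elim
  | tt => exact ⟨.tt, trivial, rfl⟩
  | atom p => exact ⟨.atom p, trivial, rfl⟩
  | and _ _ h1 h2 =>
    obtain ⟨φ, hφ, rfl⟩ := h1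
    obtain ⟨ψ, hψ, rfl⟩ := h2
    exact ⟨φ.conj ψ, ⟨hφ, hψ⟩, rfl⟩
  | not _ h =>
    obtain ⟨φ, hφ, rfl⟩ := h
    exact ⟨φ.neg, hφ, rfl⟩
  | untl I hI _ _ h1 h2 =>
    obtain ⟨φ, hφ, rfl⟩ := h1
    obtain ⟨ψ, hψ, rfl⟩ := h2
    exact ⟨φ.untl ψ I, ⟨hI.resolve_right fun h => h.1, hφ, hψ⟩, rfl⟩
  | sinc I hI _ _ h1 h2 =>
    obtain ⟨φ, hφ, rfl⟩ := h1
    obtain ⟨ψ, hψ, rfl⟩ := h2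
    exact ⟨φ.sinc ψ I, ⟨hI.resolve_right fun h => h.1, hφ, hψ⟩, rfl⟩

lemma exists_mem_sepBool {ι : Type} (s : Finset ι) {X : ι → Pred P}
    (hX : ∀ i, X i ∈ SepBool K P c) : (fun f r => ∃ i ∈ s, X i f r) ∈ SepBool K P c := by
  classical
  induction s using Finset.induction_on with
  | empty =>
    convert not_mem_sepBool (tt_mem_sepBool (K := K) (P := P) (c := c)) using 1
    funext f r
    simp [Pred.not]
  | insert i s _ h =>
    convert not_mem_sepBool (and_mem_sepBool (not_mem_sepBool (hX i)) (not_mem_sepBool h)) using 1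
    funext f r
    simp only [Finset.exists_mem_insert, Pred.not, Pred.and, eq_iff_iff]
    exact or_iff_not_and_not

end SepBool

/-- In each bounded window around a point, the property coincides with one of finitely many
bounded ones, selected by conditions at that point. -/
def LocallyBounded (K : AddSubgroup ℝ) (c : ℝ) (X : Pred P) : Prop :=
  ∀ M : ℝ, ∃ (ι : Type) (_ : Fintype ι) (χ β : ι → Pred P),
    (∀ i, χ i ∈ SepBool K P c) ∧ (∀ i, Gen K False False ∅ (β i)) ∧
    (∀ f r, ∃ i, χ i f r) ∧
    ∀ i f r, χ i f r → ∀ t, |t - r| ≤ M → (X f t ↔ β i f t)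

section LocallyBounded

variable {c : ℝ}

lemma locallyBounded_of_gen {X : Pred P} (hX : Gen K False False ∅ X) :
    LocallyBounded K c X := fun _ =>
  ⟨Unit, inferInstance, fun _ _ _ => True, fun _ => X, fun _ => tt_mem_sepBool, fun _ => hX,
    fun _ _ => ⟨(), trivial⟩, fun _ _ _ _ _ _ => Iff.rfl⟩

/-- Locally bounded properties are closed under operations of bounded reach. -/
lemma LocallyBounded.map₂ {X Y : Pred P} (hX : LocallyBounded K c X)
    (hY : LocallyBounded K c Y) (F : Pred P → Pred P → Pred P) (m : ℝ)
    (hF : ∀ A B, Gen K False False ∅ A → Gen K False False ∅ B → Gen K False False ∅ (F A B))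
    (hcongr : ∀ A B f t, (∀ u, |u - t| ≤ m → (X f u ↔ A f u)) →
      (∀ u, |u - t| ≤ m → (Y f u ↔ B f u)) → (F X Y f t ↔ F A B f t)) :
    LocallyBounded K c (F X Y) := by
  intro M
  obtain ⟨ι, _, χ, β, h1, h2, h3, h4⟩ := hX (M + m)
  obtain ⟨κ, _, χ', β', h1', h2', h3', h4'⟩ := hY (M + m)
  refine ⟨ι × κ, inferInstance, fun i => (χ i.1).and (χ' i.2), fun i => F (β i.1) (β' i.2),
    fun i => and_mem_sepBool (h1 _) (h1' _), fun i => hF _ _ (h2 _) (h2' _),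
    fun f r => ?_, fun i f r hi t ht => hcongr _ _ _ _
      (fun u hu => h4 _ f r hi.1 u (abs_sub_le_add hu ht))
      fun u hu => h4' _ f r hi.2 u (abs_sub_le_add hu ht)⟩
  obtain ⟨i, hi⟩ := h3 f r
  obtain ⟨j, hj⟩ := h3' f r
  exact ⟨(i, j), hi, hj⟩

lemma stable_locallyBounded : Stable K {X : Pred P | LocallyBounded K c X} where
  tt := locallyBounded_of_gen .tt
  atom p := locallyBounded_of_gen (.atom p)
  and hX hY := LocallyBounded.map₂ hX hY Pred.and 0 (fun _ _ => Gen.and) fun _ _ _ t h1 h2 =>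
    and_congr (h1 t (by simp)) (h2 t (by simp))
  not hX := LocallyBounded.map₂ hX hX (fun X _ => X.not) 0 (fun _ _ h _ => h.not)
    fun _ _ _ t h1 _ => not_congr (h1 t (by simp))
  untl I hI hX hY := by
    obtain ⟨m, -, hm⟩ := hI.exists_le
    exact LocallyBounded.map₂ hX hY (fun X Y => X.untl Y I) m
      (fun _ _ => Gen.untl I (Or.inl hI)) fun _ _ _ _ => untl_iff_of_near hm
  sinc I hI hX hY := by
    obtain ⟨m, -, hm⟩ := hI.exists_le
    exact LocallyBounded.map₂ hX hY (fun X Y => X.sinc Y I) m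
      (fun _ _ => Gen.sinc I (Or.inl hI)) fun _ _ _ _ => sinc_iff_of_near hm

lemma LocallyBounded.mirror {X : Pred P} (hX : LocallyBounded K c X) :
    LocallyBounded K c X.mirror := by
  intro M
  obtain ⟨ι, hι, χ, β, h1, h2, h3, h4⟩ := hX M
  refine ⟨ι, hι, fun i => (χ i).mirror, fun i => (β i).mirror,
    fun i => mirror_mem_sepBool (h1 i), fun i => (h2 i).mirror fun _ h => h.elim,
    fun f r => h3 _ _, fun i f r hi t ht => h4 i _ _ hi _ ?_⟩
  rwa [neg_sub_neg, abs_sub_comm]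

lemma LocallyBounded.mem_sepBool {X : Pred P} (hX : LocallyBounded K c X) :
    X ∈ SepBool K P c := by
  obtain ⟨ι, _, χ, β, h1, h2, h3, h4⟩ := hX 0
  convert exists_mem_sepBool Finset.univ fun i => and_mem_sepBool (h1 i) (h2 i).mem_sepBool using 1
  funext f r
  apply propext
  constructor
  · intro h
    obtain ⟨i, hi⟩ := h3 f r
    exact ⟨i, Finset.mem_univ i, hi, (h4 i f r hi r (by simp)).1 h⟩
  · rintro ⟨i, -, hi, h⟩
    exact (h4 i f r hi r (by simp)).2 h

lemma Gen.exists_pr_lt_top {X : Pred P} (hX : Gen K True False ∅ X) :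
    ∃ φ : MTL K P, φ.pr < ⊤ ∧ φ.den = X := by
  induction hX with
  | base h => exact h.elim
  | tt => exact ⟨.tt, WithTop.coe_lt_top (0 : ℝ), rfl⟩
  | atom p => exact ⟨.atom p, WithTop.coe_lt_top (0 : ℝ), rfl⟩
  | and _ _ h1 h2 =>
    obtain ⟨φ, hφ, rfl⟩ := h1
    obtain ⟨ψ, hψ, rfl⟩ := h2
    exact ⟨φ.conj ψ, max_lt hφ hψ, rfl⟩
  | not _ h =>
    obtain ⟨φ, hφ, rfl⟩ := h
    exact ⟨φ.neg, hφ, rfl⟩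
  | untl I hI _ _ h1 h2 =>
    obtain ⟨φ, hφ, rfl⟩ := h1
    obtain ⟨ψ, hψ, rfl⟩ := h2
    refine ⟨φ.untl ψ I, max_lt hφ ?_, rfl⟩
    obtain ⟨x, hx⟩ := WithTop.ne_top_iff_exists.1 hψ.ne
    rw [← hx, WithTop.map_coe]
    exact WithTop.coe_lt_top _
  | sinc I hI _ _ h1 h2 =>
    obtain ⟨φ, hφ, rfl⟩ := h1
    obtain ⟨ψ, hψ, rfl⟩ := h2
    refine ⟨φ.sinc ψ I, WithTop.add_lt_top.2 ⟨?_, max_lt hφ hψ⟩, rfl⟩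
    obtain ⟨m, hm⟩ := Option.ne_none_iff_exists'.1 (hI.resolve_right fun h => h.1)
    rw [MTLI.supW, hm]
    exact WithTop.coe_lt_top _

lemma Gen.locallyBounded (hnt : K ≠ ⊥) {X : Pred P} (hX : Gen K True False ∅ X) :
    LocallyBounded K c X := by
  have hS := stable_locallyBounded (K := K) (P := P) (c := c)
  induction hX with
  | base h => exact h.elim
  | tt => exact hS.tt
  | atom p => exact hS.atom p
  | and _ _ h1 h2 => exact hS.and h1 h2
  | not _ h => exact hS.not h
  | sinc I hI _ _ h1 h2 => exact hS.sinc I (hI.resolve_right fun h => h.1) h1 h2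
  | @untl X Y I hI hX hY ih1 ih2 =>
    rcases hI with hI | ⟨-, rfl⟩
    · exact hS.untl I hI ih1 ih2
    intro M
    obtain ⟨φ, hφ, hden⟩ := (Gen.untl _ (Or.inr ⟨trivial, rfl⟩) hX hY).exists_pr_lt_top
    rw [untl_full_eq] at hden ⊢
    obtain ⟨p, hp⟩ := WithTop.ne_top_iff_exists.1 hφ.ne
    obtain ⟨N, hm, hN0, hN⟩ := exists_mem_gt hnt (max M (p + c))
    obtain ⟨L, hLm, hL0, hL⟩ := exists_mem_gt hnt (N + M)
    have hMN := (le_max_left _ _).trans_lt hN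
    have hpN := (le_max_right _ _).trans_lt hN
    have hB := stable_gen (K := K) (P := P) False False ∅
    set Q : Pred P := fun f r => LineU (X f) (Y f) (r + N)
    have hQ : Q ∈ SepBool K P c := by
      refine ⟨MTL.untl .tt φ (MTLI.single N hm hN0), .base (Or.inl ⟨N, hm, hN0, φ, rfl, ?_⟩), ?_⟩
      · rw [← hp]
        exact WithTop.coe_lt_coe.2 (by linarith)
      · funext f r
        have : ∀ t, φ.sat f t ↔ LineU (X f) (Y f) t := fun t =>
          iff_of_eq (congrFun (congrFun hden f) t)
        simp only [MTL.den, MTL.sat, MTLI.mem_single, this, eq_iff_iff, Q]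
        constructor
        · rintro ⟨t, -, h, hU, -⟩
          rwa [← h, add_sub_cancel]
        · exact fun h => ⟨r + N, by linarith, by ring, h, fun _ _ _ => trivial⟩
    have hQb : ∀ b : Bool, (fun f r => Q f r ↔ b = true) ∈ SepBool K P c := by
      rintro (_ | _)
      · convert not_mem_sepBool hQ using 1
        funext f r
        simp [Pred.not]
      · simpa using hQ
    obtain ⟨ι, _, χ, β, h1, h2, h3, h4⟩ := ih1 (M + L)
    obtain ⟨κ, _, χ', β', h1', h2', h3', h4'⟩ := ih2 (M + L)
    refine ⟨ι × κ × Bool, inferInstance,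
      fun i => (χ i.1).and ((χ' i.2.1).and fun f r => Q f r ↔ i.2.2 = true),
      fun i f t => LineUB L (β i.1 f) (β' i.2.1 f) t ∨
        ((∀ u, t < u → u - t < L → β i.1 f u) ∧ i.2.2 = true),
      fun i => and_mem_sepBool (h1 _) (and_mem_sepBool (h1' _) (hQb _)),
      fun i => hB.or' (hB.lineUB (h2 _) (h2' _) hLm hL0)
        (hB.and (hB.forall_future (h2 _) hLm hL0) (hB.const _)), fun f r => ?_, ?_⟩
    · classical
      obtain ⟨i, hi⟩ := h3 f r
      obtain ⟨j, hj⟩ := h3' f r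
      exact ⟨(i, j, decide (Q f r)), hi, hj, by simp⟩
    · rintro ⟨i, j, b⟩ f r ⟨hi, hj, hb⟩ t ht
      have hX' : ∀ u, t < u → u - t < L → (X f u ↔ β i f u) := fun u hu huL =>
        h4 i f r hi u (abs_sub_le_add (by rw [abs_le]; constructor <;> linarith) ht)
      have hY' : ∀ u, t < u → u - t < L → (Y f u ↔ β' j f u) := fun u hu huL =>
        h4' j f r hj u (abs_sub_le_add (by rw [abs_le]; constructor <;> linarith) ht)
      rw [abs_le] at ht
      change LineU (X f) (Y f) t ↔ LineUB L (β i f) (β' j f) t ∨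
        ((∀ u, t < u → u - t < L → β i f u) ∧ b = true)
      rw [lineU_iff_of_far (q := r + N) (L := L) (by linarith) (by linarith)]
      refine or_congr (exists_congr fun u => and_congr_right fun hu => and_congr_right fun huL =>
        and_congr (hY' u hu huL) (forall_congr' fun w => forall_congr' fun hw =>
          forall_congr' fun hwu => hX' w hw (by linarith))) (and_congr ?_ hb)
      exact forall_congr' fun u => forall_congr' fun hu => forall_congr' fun huL => hX' u hu huL

end LocallyBounded

lemma separated_subset_sepBool (hnt : K ≠ ⊥) (c : ℝ) :
    Separated K P ⊆ SepBool K P c := by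
  intro X hX
  refine LocallyBounded.mem_sepBool
    (Gen.mem_of_stable (stable_locallyBounded (c := c)) (fun Y hY => ?_) hX)
  rcases hY with hY | hY
  · exact hY.locallyBounded hnt
  · have := ((hY.mirror (H := ∅) fun _ h => h.elim).locallyBounded hnt (c := c)).mirror
    rwa [Pred.mirror_mirror] at this

/-- **Lemma 7 (syntactic separation).** Let `K` be a nontrivial additive subgroup of `ℝ` and
`c ∈ K`, `c ≥ 0`.  Every `MTL_K` formula is equivalent to a boolean combination of:
`◇_{{N}} θ` with `pr(θ) < N - c`; `◇⁻_{{N}} θ` with `fr(θ) < N - c`; and formulas in which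
all intervals occurring in the temporal operators are bounded. -/
theorem mtl_separation (K : AddSubgroup ℝ) (hnt : K ≠ ⊥) (c : K) (hc : 0 ≤ (c : ℝ))
    (φ : MTL K ℕ) :
    ∃ φ' : MTL K ℕ, MTL.BC (SepKind ((c : ℝ))) φ' ∧ EquivMTL φ φ' := by
  obtain ⟨φ', hφ', h⟩ := separated_subset_sepBool hnt (c : ℝ) (den_mem_separated hnt φ)
  exact ⟨φ', hφ', fun f r => (iff_of_eq (congrFun (congrFun h f) r)).symm⟩

end MTLPaper
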